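/- arXiv:2411.09482 — 2 statements merged into one kernel-verified Lean document; each statement's English description precedes it below -/
import Mathlib

section
/- Let d ≥ 2 be an integer, s ∈ (0, d/2) and α ∈ (0,1) with s + α > 1. For n ∈ ℝ^d \ {0} define the d×d matrix ℍ_{d,s,α}(n) := ∫_{ℝ^d} ⟨n−k⟩^{−d−2α} (|k|^{−2s} − |n|^{−2s}) |P⊥_{n−k} k|² I dk + (d−1) ∫_{ℝ^d} ⟨n−k⟩^{−d−2α} |k|^{−2s} k kᵀ dk − 2 ∫_{ℝ^d} ⟨n−k⟩^{−d−2α} |k|^{−2s} P⊥_{n−k} k kᵀ dk, and set η_{d,s,α} := C_{d,s,α} · ( (d−1)(s+α−1)(d+2−2s−2α) − α(d−1)(d+2α) + 4α(s+α−1) ). Then there exists a constant ρ ≥ 0 such that for every n ∈ ℝ^d \ {0} and every unit vector v ∈ ℝ^d with v·n = 0, one has |v · ℍ_{d,s,α}(n) v + η_{d,s,α} |n|^{−2s+2−2α}| ≤ ρ |n|^{−2s}. -/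
open MeasureTheory
open scoped RealInnerProductSpace

noncomputable section

/-- The Japanese bracket `⟨x⟩ = (1+|x|²)^{1/2}`. -/
def jap {d : ℕ} (x : EuclideanSpace ℝ (Fin d)) : ℝ := Real.sqrt (1 + ‖x‖^2)

/-- The orthogonal projection `P⊥_k x = x − (k·x/|k|²) k` onto the hyperplane orthogonal
to `k` (junk value: the identity, when `k = 0`). -/
def Pperp {d : ℕ} (k x : EuclideanSpace ℝ (Fin d)) : EuclideanSpace ℝ (Fin d) :=
  x - (⟪k, x⟫ / ‖k‖^2) • k

/-- The constant `C_{d,s,α}`. -/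
def Cconst (d : ℕ) (s α : ℝ) : ℝ :=
  -(Real.pi ^ ((d : ℝ)/2) * Real.Gamma (s + α - 1) * Real.Gamma (((d : ℝ) - 2*s + 2)/2)
      * Real.Gamma (-α)) /
    (4 * Real.Gamma s * Real.Gamma (((d : ℝ) + 2 + 2*α)/2)
      * Real.Gamma (((d : ℝ) + 4 - 2*s - 2*α)/2))

/-- The regularization constant `η_{d,s,α}`. -/
def etaC (d : ℕ) (s α : ℝ) : ℝ :=
  Cconst d s α *
    (((d : ℝ) - 1)*(s + α - 1)*((d : ℝ) + 2 - 2*s - 2*α)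
      - α*((d : ℝ) - 1)*((d : ℝ) + 2*α) + 4*α*(s + α - 1))

/-- The matrix-valued integral `ℍ_{d,s,α}(n)`. -/
def Hmat (d : ℕ) (s α : ℝ) (n : EuclideanSpace ℝ (Fin d)) : Matrix (Fin d) (Fin d) ℝ :=
  (Matrix.of fun i j => ∫ k : EuclideanSpace ℝ (Fin d),
      jap (n - k) ^ (-(d : ℝ) - 2*α) * (‖k‖ ^ (-(2*s)) - ‖n‖ ^ (-(2*s)))
        * ‖Pperp (n - k) k‖^2 * (if i = j then (1:ℝ) else 0))
  + ((d : ℝ) - 1) • (Matrix.of fun i j => ∫ k : EuclideanSpace ℝ (Fin d),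
      jap (n - k) ^ (-(d : ℝ) - 2*α) * ‖k‖ ^ (-(2*s)) * (k i * k j))
  - (2 : ℝ) • (Matrix.of fun i j => ∫ k : EuclideanSpace ℝ (Fin d),
      jap (n - k) ^ (-(d : ℝ) - 2*α) * ‖k‖ ^ (-(2*s)) * (Pperp (n - k) k i * k j))

section LaplaceIntegrals

open Set Filter Topology Real

lemma integrableOn_rpow_mul_exp_neg_mul {a r : ℝ} (ha : 0 < a) (hr : 0 < r) :
    IntegrableOn (fun t : ℝ => t ^ (a - 1) * exp (-(r * t))) (Ioi 0) :=
  .of_integral_ne_zero (by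
    rw [integral_rpow_mul_exp_neg_mul_Ioi ha hr]
    have := Gamma_pos_of_pos ha
    positivity)

/-- Fubini's theorem for a Laplace-type subordination `K = ∫ m(w) e^{-wρ} dw`. -/
lemma integrable_integral_laplace {X : Type*} [MeasurableSpace X] (ν : Measure X) [SFinite ν]
    {m : ℝ → ℝ} (hm : Measurable m) (hm0 : ∀ w, 0 < w → 0 ≤ m w)
    {ρ F K : X → ℝ} (hρ : Measurable ρ) (hF : Measurable F)
    (hK : ∀ᵐ x ∂ν, IntegrableOn (fun w => m w * exp (-(w * ρ x))) (Ioi 0) ∧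
      ∫ w in Ioi (0 : ℝ), m w * exp (-(w * ρ x)) = K x)
    (hKF : Integrable (fun x => K x * F x) ν) :
    IntegrableOn (fun w => m w * ∫ x, exp (-(w * ρ x)) * F x ∂ν) (Ioi 0) ∧
      ∫ x, K x * F x ∂ν = ∫ w in Ioi (0 : ℝ), m w * ∫ x, exp (-(w * ρ x)) * F x ∂ν := by
  have hFint : Integrable (Function.uncurry fun (x : X) (w : ℝ) => m w * (exp (-(w * ρ x)) * F x))
      (ν.prod (volume.restrict (Ioi 0))) := by
    rw [integrable_prod_iff (by
      apply Measurable.aestronglyMeasurable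
      simp only [Function.uncurry_def]
      fun_prop)]
    constructor
    · filter_upwards [hK] with x hx
      have := hx.1.mul_const (F x)
      simpa only [Function.uncurry_apply_pair, mul_assoc] using this
    · refine hKF.norm.congr ?_
      filter_upwards [hK] with x hx
      have h1 : ∫ w in Ioi (0 : ℝ), ‖m w * (exp (-(w * ρ x)) * F x)‖
          = ∫ w in Ioi (0 : ℝ), m w * exp (-(w * ρ x)) * ‖F x‖ := by
        refine setIntegral_congr_fun measurableSet_Ioi fun w hw => ?_
        simp only [norm_mul, norm_of_nonneg (hm0 w hw), norm_of_nonneg (exp_nonneg _)]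
        ring
      have h2 : 0 ≤ K x := by
        rw [← hx.2]
        exact setIntegral_nonneg measurableSet_Ioi fun w hw => mul_nonneg (hm0 w hw) (exp_nonneg _)
      simp only [Function.uncurry_apply_pair]
      rw [h1, integral_mul_const, hx.2, norm_mul, norm_of_nonneg h2]
  constructor
  · have := hFint.integral_prod_right
    simpa only [Function.uncurry_apply_pair, integral_const_mul, IntegrableOn] using this
  · have := integral_integral_swap hFint
    simp only [integral_const_mul] at this
    rw [← this]
    refine integral_congr_ae ?_
    filter_upwards [hK] with x hx
    simp only [← mul_assoc]
    rw [integral_mul_const, hx.2]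

lemma integrableOn_rpow_mul_min {α : ℝ} (hα0 : 0 < α) (hα1 : α < 1) :
    IntegrableOn (fun w : ℝ => w ^ (α - 2) * min 1 w) (Ioi 0) := by
  rw [← Ioc_union_Ioi_eq_Ioi zero_le_one]
  refine IntegrableOn.union ?_ ?_
  · have h : IntegrableOn (fun w : ℝ => w ^ (α - 1)) (Ioc 0 1) := by
      have := intervalIntegral.intervalIntegrable_rpow' (a := 0) (b := 1) (r := α - 1) (by linarith)
      rwa [intervalIntegrable_iff_integrableOn_Ioc_of_le zero_le_one] at this
    refine h.congr_fun (fun w hw => ?_) measurableSet_Ioc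
    simp only [min_eq_right hw.2]
    rw [← rpow_add_one hw.1.ne']
    ring_nf
  · refine (integrableOn_Ioi_rpow_of_lt (a := α - 2) (by linarith) one_pos).congr_fun
      (fun w hw => ?_) measurableSet_Ioi
    simp only [min_eq_left (le_of_lt (mem_Ioi.1 hw)), mul_one]

/-- Asymptotics of a Laplace-type double integral whose outer weight `k(w)` is close to the power
`c w^{q+α-2}`. -/
lemma exists_laplace_asymptotics {q α : ℝ} (hq : 0 < q) (hα0 : 0 < α) (hα1 : α < 1)
    (hσ : 0 < q + α - 1) {Φ k : ℝ → ℝ} (hΦm : Measurable Φ) {M : ℝ}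
    (hΦ : ∀ z, 0 < z → |Φ z| ≤ M * z ^ (q - 1))
    (hΦi : IntegrableOn (fun z => z ^ (-(q + α - 1)) * Φ z) (Ioi 0))
    (hkm : Measurable k) {c M' : ℝ}
    (hk : ∀ w, 0 < w → |k w - c * w ^ (q + α - 2)| ≤ M' * (w ^ (q + α - 2) * min 1 w)) :
    ∃ ρ : ℝ, 0 ≤ ρ ∧ ∀ L : ℝ, 0 < L →
      |(∫ w in Ioi (0 : ℝ), k w * ∫ z in Ioi (0 : ℝ), exp (-(w * (L * z))) * Φ z)
        - c * Gamma (q + α - 1) * L ^ (-(q + α - 1)) *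
          ∫ z in Ioi (0 : ℝ), z ^ (-(q + α - 1)) * Φ z| ≤ ρ * L ^ (-q) := by
  have hM : 0 ≤ M := by
    have := (abs_nonneg _).trans (hΦ 1 one_pos)
    simpa using this
  have hM' : 0 ≤ M' := by
    have := (abs_nonneg _).trans (hk 1 one_pos)
    simpa using this
  have hΓ := Gamma_pos_of_pos hq
  set J := ∫ w in Ioi (0 : ℝ), w ^ (α - 2) * min 1 w with hJ
  have hJ0 : 0 ≤ J := setIntegral_nonneg measurableSet_Ioi fun w hw =>
    mul_nonneg (rpow_nonneg (le_of_lt hw) _) (le_min zero_le_one (le_of_lt hw))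
  refine ⟨M' * M * Gamma q * J, by positivity, fun L hL => ?_⟩
  set G : ℝ → ℝ := fun w => ∫ z in Ioi (0 : ℝ), exp (-(w * (L * z))) * Φ z with hG
  have hGm : StronglyMeasurable G := by
    have : StronglyMeasurable (Function.uncurry fun (w z : ℝ) => exp (-(w * (L * z))) * Φ z) := by
      apply Measurable.stronglyMeasurable
      simp only [Function.uncurry_def]
      fun_prop
    exact this.integral_prod_right
  have hGb : ∀ w, 0 < w → |G w| ≤ M * Gamma q * (w ^ (-q) * L ^ (-q)) := by
    intro w hw
    have h1 : ∀ z ∈ Ioi (0 : ℝ), ‖exp (-(w * (L * z))) * Φ z‖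
        ≤ M * (z ^ (q - 1) * exp (-(w * L * z))) := by
      intro z hz
      rw [norm_mul, norm_of_nonneg (exp_nonneg _), norm_eq_abs]
      calc _ ≤ exp (-(w * (L * z))) * (M * z ^ (q - 1)) := by
            gcongr
            exact hΦ z hz
        _ = _ := by rw [mul_assoc w]; ring
    have h2 := norm_integral_le_of_norm_le
      ((integrableOn_rpow_mul_exp_neg_mul hq (mul_pos hw hL)).const_mul M)
      ((ae_restrict_iff' measurableSet_Ioi).2 (Eventually.of_forall h1))
    rw [integral_const_mul, integral_rpow_mul_exp_neg_mul_Ioi hq (mul_pos hw hL)] at h2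
    rw [norm_eq_abs] at h2
    refine h2.trans (le_of_eq ?_)
    rw [one_div, inv_rpow (by positivity), ← rpow_neg (by positivity), mul_rpow hw.le hL.le]
    ring
  have hmain := integrable_integral_laplace (volume.restrict (Ioi (0 : ℝ)))
    (m := fun w => w ^ (q + α - 2)) (by fun_prop) (fun w hw => rpow_nonneg hw.le _)
    (ρ := fun z => L * z) (F := Φ)
    (K := fun z => Gamma (q + α - 1) * L ^ (-(q + α - 1)) * z ^ (-(q + α - 1)))
    (by fun_prop) hΦm (by
      refine (ae_restrict_iff' measurableSet_Ioi).2 (Eventually.of_forall fun z hz => ?_)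
      have hz' : 0 < z := hz
      have e : ∀ w : ℝ, w ^ (q + α - 2) * exp (-(w * (L * z)))
          = w ^ (q + α - 1 - 1) * exp (-(L * z * w)) := by
        intro w
        rw [show q + α - 2 = q + α - 1 - 1 by ring, mul_comm w]
      simp only [e]
      refine ⟨integrableOn_rpow_mul_exp_neg_mul hσ (by positivity), ?_⟩
      rw [integral_rpow_mul_exp_neg_mul_Ioi hσ (by positivity), one_div,
        inv_rpow (by positivity), ← rpow_neg (by positivity), mul_rpow hL.le hz'.le]
      ring) (by
      have := hΦi.const_mul (Gamma (q + α - 1) * L ^ (-(q + α - 1)))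
      simpa only [← mul_assoc] using this)
  have h2 : c * Gamma (q + α - 1) * L ^ (-(q + α - 1)) *
      ∫ z in Ioi (0 : ℝ), z ^ (-(q + α - 1)) * Φ z
      = ∫ w in Ioi (0 : ℝ), c * (w ^ (q + α - 2) * G w) := by
    rw [integral_const_mul, hG, ← hmain.2, ← integral_const_mul, ← integral_const_mul]
    refine integral_congr_ae (Eventually.of_forall fun z => ?_)
    simp only
    ring
  have hbd : ∀ w ∈ Ioi (0 : ℝ), ‖(k w - c * w ^ (q + α - 2)) * G w‖
      ≤ M' * M * Gamma q * L ^ (-q) * (w ^ (α - 2) * min 1 w) := by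
    intro w hw
    have hw' : 0 < w := hw
    rw [norm_mul, norm_eq_abs, norm_eq_abs]
    calc _ ≤ (M' * (w ^ (q + α - 2) * min 1 w)) * (M * Gamma q * (w ^ (-q) * L ^ (-q))) := by
          gcongr
          · exact hk w hw
          · exact hGb w hw
      _ = M' * M * Gamma q * L ^ (-q) * ((w ^ (q + α - 2) * w ^ (-q)) * min 1 w) := by ring
      _ = _ := by
        rw [← rpow_add hw', show q + α - 2 + -q = α - 2 by ring]
  have hdom := (integrableOn_rpow_mul_min hα0 hα1).const_mul (M' * M * Gamma q * L ^ (-q))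
  have hae := (ae_restrict_iff' (μ := volume) measurableSet_Ioi).2 (Eventually.of_forall hbd)
  have hi1 : IntegrableOn (fun w => (k w - c * w ^ (q + α - 2)) * G w) (Ioi 0) := by
    refine Integrable.mono' hdom ?_ hae
    exact (Measurable.mul (by fun_prop) hGm.measurable).aestronglyMeasurable
  have h3 : ∫ w in Ioi (0 : ℝ), k w * G w
      = (∫ w in Ioi (0 : ℝ), (k w - c * w ^ (q + α - 2)) * G w)
        + ∫ w in Ioi (0 : ℝ), c * (w ^ (q + α - 2) * G w) := by
    rw [← integral_add hi1 (hmain.1.const_mul c)]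
    refine integral_congr_ae (Eventually.of_forall fun w => ?_)
    simp only
    ring
  rw [h2, h3, add_sub_cancel_right]
  have h4 := norm_integral_le_of_norm_le hdom hae
  rw [integral_const_mul, norm_eq_abs] at h4
  refine h4.trans (le_of_eq ?_)
  rw [hJ]
  ring

end LaplaceIntegrals

section BetaIntegrals

open Set Filter Topology Real

lemma integral_rpow_mul_one_sub_rpow {u v : ℝ} (hu : 0 < u) (hv : 0 < v) :
    IntegrableOn (fun z : ℝ => z ^ (u - 1) * (1 - z) ^ (v - 1)) (Ioc 0 1) ∧
      ∫ z in Ioc (0 : ℝ) 1, z ^ (u - 1) * (1 - z) ^ (v - 1)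
        = Gamma u * Gamma v / Gamma (u + v) := by
  have hval : ∫ z in Ioc (0 : ℝ) 1, z ^ (u - 1) * (1 - z) ^ (v - 1)
      = Gamma u * Gamma v / Gamma (u + v) := by
    have h := ProbabilityTheory.beta_eq_betaIntegralReal u v hu hv
    rw [ProbabilityTheory.beta, Complex.betaIntegral,
      intervalIntegral.integral_of_le zero_le_one] at h
    rw [h]
    have h2 : ∫ z : ℝ in Ioc (0 : ℝ) 1, (z : ℂ) ^ ((u : ℂ) - 1) * (1 - (z : ℂ)) ^ ((v : ℂ) - 1)
        = ∫ z : ℝ in Ioc (0 : ℝ) 1, ((z ^ (u - 1) * (1 - z) ^ (v - 1) : ℝ) : ℂ) := by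
      refine setIntegral_congr_fun measurableSet_Ioc fun z hz => ?_
      simp only [Complex.ofReal_mul]
      rw [Complex.ofReal_cpow hz.1.le, Complex.ofReal_cpow (by linarith [hz.2])]
      push_cast
      rfl
    rw [h2, integral_complex_ofReal, Complex.ofReal_re]
  refine ⟨.of_integral_ne_zero ?_, hval⟩
  rw [hval]
  have := Gamma_pos_of_pos hu
  have := Gamma_pos_of_pos hv
  have := Gamma_pos_of_pos (add_pos hu hv)
  positivity

lemma integral_rpow_mul_posPart_rpow {u β : ℝ} (hu : 0 < u) (hβ : 0 < β) :
    IntegrableOn (fun z : ℝ => z ^ (u - 1) * max (1 - z) 0 ^ β) (Ioi 0) ∧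
      ∫ z in Ioi (0 : ℝ), z ^ (u - 1) * max (1 - z) 0 ^ β
        = Gamma u * Gamma (β + 1) / Gamma (u + β + 1) := by
  have h := integral_rpow_mul_one_sub_rpow hu (v := β + 1) (by linarith)
  have e1 : EqOn (fun z : ℝ => z ^ (u - 1) * (1 - z) ^ (β + 1 - 1))
      (fun z : ℝ => z ^ (u - 1) * max (1 - z) 0 ^ β) (Ioc 0 1) := by
    intro z hz
    simp only
    rw [max_eq_left (by linarith [hz.2]), add_sub_cancel_right]
  have e2 : ∀ z ∈ Ioi (0 : ℝ) \ Ioc 0 1, z ^ (u - 1) * max (1 - z) 0 ^ β = 0 := by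
    intro z hz
    have : 1 < z := by
      by_contra! h
      exact hz.2 ⟨hz.1, h⟩
    rw [max_eq_right (by linarith), zero_rpow hβ.ne', mul_zero]
  have h1 := h.1.congr_fun e1 measurableSet_Ioc
  constructor
  · exact h1.of_forall_sdiff_eq_zero measurableSet_Ioi e2
  · rw [setIntegral_eq_of_subset_of_forall_sdiff_eq_zero measurableSet_Ioi Ioc_subset_Ioi_self e2,
      ← setIntegral_congr_fun measurableSet_Ioc e1, h.2, add_assoc]

lemma abs_posPart_rpow_sub_one_le {β z : ℝ} (hβ : 0 < β) (hz : 0 < z) :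
    |max (1 - z) 0 ^ β - 1| ≤ max 1 β * z := by
  rcases le_total z 1 with h | h
  · rw [max_eq_left (by linarith)]
    have h1 : (1 - z) ^ β ≤ 1 := rpow_le_one (by linarith) (by linarith) hβ.le
    rw [abs_of_nonpos (by linarith)]
    rcases le_total 1 β with hb | hb
    · have := one_add_mul_self_le_rpow_one_add (s := -z) (by linarith) hb
      rw [max_eq_right hb]
      rw [← sub_eq_add_neg] at this
      linarith
    · have := rpow_le_rpow_of_exponent_ge' (x := 1 - z) (by linarith) (by linarith) hβ.le hb
      rw [rpow_one] at this
      rw [max_eq_left hb]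
      linarith
  · rw [max_eq_right (by linarith), zero_rpow hβ.ne', zero_sub, abs_neg, abs_one]
    calc (1 : ℝ) = 1 * 1 := by ring
      _ ≤ max 1 β * z := by gcongr; exact le_max_left _ _

lemma integral_rpow_mul_posPart_rpow_sub_one {α β : ℝ} (hα0 : 0 < α) (hα1 : α < 1) (hβ : 0 < β) :
    IntegrableOn (fun z : ℝ => z ^ (-α - 1) * (max (1 - z) 0 ^ β - 1)) (Ioi 0) ∧
      ∫ z in Ioi (0 : ℝ), z ^ (-α - 1) * (max (1 - z) 0 ^ β - 1)
        = Gamma (-α) * Gamma (β + 1) / Gamma (β + 1 - α) := by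
  have hm : Measurable fun z : ℝ => z ^ (-α - 1) * (max (1 - z) 0 ^ β - 1) := by fun_prop
  have hz : IntegrableOn (fun z : ℝ => z ^ (-α)) (Ioc 0 1) := by
    have := intervalIntegral.intervalIntegrable_rpow' (a := 0) (b := 1) (r := -α) (by linarith)
    rwa [intervalIntegrable_iff_integrableOn_Ioc_of_le zero_le_one] at this
  have hi0 : IntegrableOn (fun z : ℝ => z ^ (-α - 1) * (max (1 - z) 0 ^ β - 1)) (Ioc 0 1) := by
    refine Integrable.mono' (hz.const_mul (max 1 β)) hm.aestronglyMeasurable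
      ((ae_restrict_iff' measurableSet_Ioc).2 (Eventually.of_forall fun z hz => ?_))
    rw [norm_mul, norm_of_nonneg (rpow_nonneg hz.1.le _), norm_eq_abs]
    calc _ ≤ z ^ (-α - 1) * (max 1 β * z) := by
          gcongr
          · exact rpow_nonneg hz.1.le _
          · exact abs_posPart_rpow_sub_one_le hβ hz.1
      _ = max 1 β * (z ^ (-α - 1) * z) := by ring
      _ = _ := by rw [← rpow_add_one hz.1.ne', sub_add_cancel]
  have e1 : EqOn (fun z : ℝ => -z ^ (-α - 1))
      (fun z : ℝ => z ^ (-α - 1) * (max (1 - z) 0 ^ β - 1)) (Ioi 1) := by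
    intro z hz
    simp only
    rw [max_eq_right (by linarith [mem_Ioi.1 hz]), zero_rpow hβ.ne']
    ring
  have hi1 := ((integrableOn_Ioi_rpow_of_lt (a := -α - 1) (by linarith) one_pos).neg).congr_fun
      e1 measurableSet_Ioi
  have hB := integral_rpow_mul_one_sub_rpow (u := 1 - α) (by linarith) hβ
  have e2 : EqOn (fun z : ℝ => z ^ (-α - 1) * (max (1 - z) 0 ^ β - 1))
      (fun z : ℝ => z ^ (-α - 1) * ((1 - z) ^ β - 1)) (Ioc 0 1) := by
    intro z hz
    simp only
    rw [max_eq_left (by linarith [hz.2])]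
  have hF : ∫ z in Ioc (0 : ℝ) 1, (z ^ (-α - 1) * ((1 - z) ^ β - 1)
        + β / α * (z ^ (1 - α - 1) * (1 - z) ^ (β - 1))) = 1 / α - 0 := by
    rw [← intervalIntegral.integral_of_le zero_le_one]
    refine intervalIntegral.integral_eq_sub_of_hasDerivAt_of_tendsto
      (f := fun z => -1 / α * (z ^ (-α) * ((1 - z) ^ β - 1))) zero_lt_one ?_ ?_ ?_ ?_
    · intro z hz
      have d1 : HasDerivAt (fun z : ℝ => z ^ (-α)) (-α * z ^ (-α - 1)) z :=
        hasDerivAt_rpow_const (Or.inl hz.1.ne')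
      have d2 : HasDerivAt (fun z : ℝ => (1 - z) ^ β - 1) (-1 * β * (1 - z) ^ (β - 1)) z :=
        (((hasDerivAt_id z).const_sub 1).rpow_const (Or.inl (by
          simp only [id]
          linarith [hz.2]))).sub_const 1
      refine ((d1.mul d2).const_mul (-1 / α)).congr_deriv ?_
      rw [show 1 - α - 1 = -α by ring]
      field_simp
      ring
    · rw [intervalIntegrable_iff_integrableOn_Ioc_of_le zero_le_one]
      exact (hi0.congr_fun e2 measurableSet_Ioc).add (hB.1.const_mul _)
    · have hb : ∀ᶠ z in 𝓝[>] (0 : ℝ), ‖-1 / α * (z ^ (-α) * ((1 - z) ^ β - 1))‖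
          ≤ 1 / α * max 1 β * z ^ (1 - α) := by
        filter_upwards [Ioo_mem_nhdsGT (zero_lt_one (α := ℝ))] with z hz
        have := abs_posPart_rpow_sub_one_le hβ hz.1
        rw [max_eq_left (by linarith [hz.2])] at this
        rw [norm_mul, norm_mul, norm_of_nonneg (rpow_nonneg hz.1.le _),
          norm_eq_abs ((1 - z) ^ β - 1),
          norm_div, norm_neg, norm_one, norm_of_nonneg hα0.le]
        calc _ ≤ 1 / α * (z ^ (-α) * (max 1 β * z)) := by
              have := rpow_nonneg hz.1.le (-α)
              gcongr
          _ = 1 / α * max 1 β * (z ^ (-α) * z) := by ring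
          _ = _ := by rw [← rpow_add_one hz.1.ne', neg_add_eq_sub]
      refine squeeze_zero_norm' hb ?_
      have : Tendsto (fun z : ℝ => 1 / α * max 1 β * z ^ (1 - α)) (𝓝 0)
          (𝓝 (1 / α * max 1 β * 0 ^ (1 - α))) :=
        ((continuous_rpow_const (by linarith)).const_mul _).tendsto 0
      rw [zero_rpow (by linarith), mul_zero] at this
      exact this.mono_left nhdsWithin_le_nhds
    · have : ContinuousAt (fun z : ℝ => -1 / α * (z ^ (-α) * ((1 - z) ^ β - 1))) 1 := by
        refine continuousAt_const.mul (ContinuousAt.mul ?_ ?_)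
        · exact continuousAt_rpow_const _ _ (Or.inl one_ne_zero)
        · exact (((continuous_const.sub continuous_id).rpow_const
            (fun _ => Or.inr hβ.le)).sub continuous_const).continuousAt
      have h := this.tendsto
      simp only [one_rpow, sub_self, zero_rpow hβ.ne', zero_sub, one_mul] at h
      rw [show -1 / α * -1 = 1 / α by ring] at h
      exact h.mono_left nhdsWithin_le_nhds
  constructor
  · rw [← Ioc_union_Ioi_eq_Ioi zero_le_one]
    exact hi0.union hi1
  · rw [← Ioc_union_Ioi_eq_Ioi zero_le_one, setIntegral_union Ioc_disjoint_Ioi_same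
      measurableSet_Ioi hi0 hi1, ← setIntegral_congr_fun measurableSet_Ioi e1,
      setIntegral_congr_fun measurableSet_Ioc e2, integral_neg,
      integral_Ioi_rpow_of_lt (by linarith) one_pos]
    rw [integral_add (hi0.congr_fun e2 measurableSet_Ioc) (hB.1.const_mul _),
      integral_const_mul, hB.2] at hF
    have g1 : Gamma (1 - α) = -α * Gamma (-α) := by
      rw [← Gamma_add_one (by linarith : -α ≠ 0)]
      congr 1
      ring
    have g2 : Gamma (β + 1) = β * Gamma β := Gamma_add_one hβ.ne'
    rw [show 1 - α + β = β + 1 - α by ring, g1] at hF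
    rw [eq_sub_iff_add_eq.mpr hF |>.trans rfl, g2, one_rpow]
    have hΓ : Gamma (β + 1 - α) ≠ 0 := (Gamma_pos_of_pos (by linarith)).ne'
    rw [show -α - 1 + 1 = -α by ring]
    field_simp
    ring

end BetaIntegrals

section BracketKernels

open Set Filter Topology Real

/-- The weight `w ↦ w^{a-1} e^{-w} / Γ(a)`, whose Laplace transform is `(1+q)^{-a}`. -/
def gammaWeight (a w : ℝ) : ℝ := w ^ (a - 1) * exp (-w) / Gamma a

/-- The regularized lower incomplete Gamma function, whose Laplace transform is `(1+q)^{-a}/q`. -/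
def gammaPrimitive (a w : ℝ) : ℝ := ∫ t in (0 : ℝ)..w, gammaWeight a t

lemma measurable_gammaWeight (a : ℝ) : Measurable (gammaWeight a) := by
  unfold gammaWeight
  fun_prop

lemma gammaWeight_nonneg {a w : ℝ} (ha : 0 < a) (hw : 0 ≤ w) : 0 ≤ gammaWeight a w := by
  have := Gamma_pos_of_pos ha
  unfold gammaWeight
  positivity

lemma continuous_gammaWeight {a : ℝ} (ha : 1 ≤ a) : Continuous (gammaWeight a) := by
  unfold gammaWeight
  have := continuous_rpow_const (sub_nonneg.2 ha)
  fun_prop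

lemma continuous_gammaPrimitive {a : ℝ} (ha : 1 ≤ a) : Continuous (gammaPrimitive a) :=
  intervalIntegral.continuous_primitive
    (fun _ _ => (continuous_gammaWeight ha).intervalIntegrable _ _) 0

lemma gammaPrimitive_nonneg {a w : ℝ} (ha : 0 < a) (hw : 0 ≤ w) : 0 ≤ gammaPrimitive a w :=
  intervalIntegral.integral_nonneg hw fun _ ht => gammaWeight_nonneg ha ht.1

lemma abs_gammaWeight_sub_le {a w : ℝ} (ha : 0 < a) (hw : 0 ≤ w) :
    |gammaWeight a w - 1 / Gamma a * w ^ (a - 1)| ≤ 1 / Gamma a * (w ^ (a - 1) * min 1 w) := by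
  have hΓ := Gamma_pos_of_pos ha
  have h1 : gammaWeight a w - 1 / Gamma a * w ^ (a - 1)
      = 1 / Gamma a * (w ^ (a - 1) * -(1 - exp (-w))) := by
    unfold gammaWeight
    field_simp
    ring
  have h2 : |-(1 - exp (-w))| ≤ min 1 w := by
    rw [abs_neg, abs_of_nonneg (by linarith [exp_le_one_iff.2 (neg_nonpos.2 hw)])]
    exact le_min (by linarith [exp_pos (-w)]) (by linarith [add_one_le_exp (-w)])
  have h3 := rpow_nonneg hw (a - 1)
  rw [h1, abs_mul, abs_mul, abs_of_pos (by positivity : 0 < 1 / Gamma a), abs_of_nonneg h3]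
  gcongr

lemma abs_gammaPrimitive_sub_le {a w : ℝ} (ha : 1 ≤ a) (hw : 0 ≤ w) :
    |gammaPrimitive a w - 1 / Gamma (a + 1) * w ^ a| ≤ 1 / Gamma (a + 1) * (w ^ a * min 1 w) := by
  have ha0 : 0 < a := by linarith
  have hΓ := Gamma_pos_of_pos ha0
  have hc := continuous_rpow_const (sub_nonneg.2 ha)
  have hp : ∫ t in (0 : ℝ)..w, 1 / Gamma a * t ^ (a - 1) = 1 / Gamma (a + 1) * w ^ a := by
    rw [intervalIntegral.integral_const_mul, integral_rpow (Or.inl (by linarith)),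
      Gamma_add_one ha0.ne', sub_add_cancel, zero_rpow ha0.ne']
    field_simp
    ring
  rw [gammaPrimitive, ← hp, ← intervalIntegral.integral_sub
    ((continuous_gammaWeight ha).intervalIntegrable _ _)
    ((hc.const_mul _).intervalIntegrable _ _)]
  have hb : ∀ t ∈ Ioc (0 : ℝ) w, ‖gammaWeight a t - 1 / Gamma a * t ^ (a - 1)‖
      ≤ 1 / Gamma a * t ^ (a - 1) * min 1 w := by
    intro t ht
    refine (abs_gammaWeight_sub_le ha0 ht.1.le).trans ?_
    rw [← mul_assoc]
    have := rpow_nonneg ht.1.le (a - 1)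
    gcongr
    exact ht.2
  have h := intervalIntegral.norm_integral_le_of_norm_le (μ := volume) hw (Eventually.of_forall hb)
    (((hc.const_mul _).mul_const _).intervalIntegrable _ _)
  rwa [intervalIntegral.integral_mul_const, hp, mul_assoc, norm_eq_abs] at h

lemma integral_gammaWeight_mul_exp {a q : ℝ} (ha : 0 < a) (hq : 0 ≤ q) :
    IntegrableOn (fun w => gammaWeight a w * exp (-(w * q))) (Ioi 0) ∧
      ∫ w in Ioi (0 : ℝ), gammaWeight a w * exp (-(w * q)) = (1 + q) ^ (-a) := by
  have hΓ := Gamma_pos_of_pos ha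
  have e : (fun w => gammaWeight a w * exp (-(w * q)))
      = fun w => 1 / Gamma a * (w ^ (a - 1) * exp (-((1 + q) * w))) := by
    funext w
    unfold gammaWeight
    rw [show -((1 + q) * w) = -w + -(w * q) by ring, exp_add]
    ring
  rw [e]
  refine ⟨(integrableOn_rpow_mul_exp_neg_mul ha (by linarith)).const_mul _, ?_⟩
  rw [integral_const_mul, integral_rpow_mul_exp_neg_mul_Ioi ha (by linarith), one_div (1 + q),
    inv_rpow (by linarith), ← rpow_neg (by linarith)]
  field_simp

lemma integral_gammaPrimitive_mul_exp {a q : ℝ} (ha : 1 ≤ a) (hq : 0 < q) :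
    IntegrableOn (fun w => gammaPrimitive a w * exp (-(w * q))) (Ioi 0) ∧
      ∫ w in Ioi (0 : ℝ), gammaPrimitive a w * exp (-(w * q)) = (1 + q) ^ (-a) / q := by
  have ha0 : 0 < a := by linarith
  have hΓ := Gamma_pos_of_pos (add_pos ha0 one_pos)
  have hc := continuous_gammaPrimitive ha
  have hub : ∀ w, 0 ≤ w → ‖gammaPrimitive a w‖ ≤ 2 / Gamma (a + 1) * w ^ a := by
    intro w hw
    have h1 := abs_gammaPrimitive_sub_le ha hw
    have h2 : w ^ a * min 1 w ≤ w ^ a * 1 := by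
      have := rpow_nonneg hw a
      gcongr
      exact min_le_left _ _
    have h3 : 1 / Gamma (a + 1) * (w ^ a * min 1 w) ≤ 1 / Gamma (a + 1) * (w ^ a * 1) := by gcongr
    rw [norm_of_nonneg (gammaPrimitive_nonneg ha0 hw)]
    have h4 := (abs_le.1 h1).2
    have : 2 / Gamma (a + 1) * w ^ a =
        1 / Gamma (a + 1) * (w ^ a * 1) + 1 / Gamma (a + 1) * w ^ a := by
      ring
    linarith
  have hI : IntegrableOn (fun w => gammaPrimitive a w * exp (-(w * q))) (Ioi 0) := by
    refine Integrable.mono' ((integrableOn_rpow_mul_exp_neg_mul (a := a + 1) (by linarith)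
      hq).const_mul (2 / Gamma (a + 1))) (by fun_prop)
      ((ae_restrict_iff' measurableSet_Ioi).2 (Eventually.of_forall fun w hw => ?_))
    rw [norm_mul, norm_of_nonneg (exp_nonneg _), add_sub_cancel_right, mul_comm q, ← mul_assoc]
    gcongr
    exact hub w (le_of_lt hw)
  refine ⟨hI, ?_⟩
  have hW := integral_gammaWeight_mul_exp ha0 hq.le
  have hu : ∀ w ∈ Ioi (0 : ℝ), HasDerivAt (gammaPrimitive a) (gammaWeight a w) w := fun w _ =>
    intervalIntegral.integral_hasDerivAt_right ((continuous_gammaWeight ha).intervalIntegrable _ _)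
      ((continuous_gammaWeight ha).stronglyMeasurableAtFilter _ _)
      (continuous_gammaWeight ha).continuousAt
  have hv : ∀ w ∈ Ioi (0 : ℝ),
      HasDerivAt (fun w => -1 / q * exp (-(w * q))) (exp (-(w * q))) w := by
    intro w _
    refine (((((hasDerivAt_id w).mul_const q).neg).exp).const_mul (-1 / q)).congr_deriv ?_
    change -1 / q * (exp (-(w * q)) * -(1 * q)) = exp (-(w * q))
    field_simp
  have h := integral_Ioi_mul_deriv_eq_deriv_mul (a' := 0) (b' := 0) hu hv hI (by
    have : IntegrableOn (fun w => -1 / q * (gammaWeight a w * exp (-(w * q)))) (Ioi 0) :=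
      hW.1.const_mul (-1 / q)
    refine this.congr_fun (fun w _ => ?_) measurableSet_Ioi
    simp only [Pi.mul_apply]
    ring) (by
    have : Continuous (gammaPrimitive a * fun w => -1 / q * exp (-(w * q))) := by
      apply hc.mul
      fun_prop
    have h := this.tendsto 0
    simp only [Pi.mul_apply, gammaPrimitive, intervalIntegral.integral_same, zero_mul] at h
    exact h.mono_left nhdsWithin_le_nhds) (by
    have h1 := (tendsto_rpow_mul_exp_neg_mul_atTop_nhds_zero a q hq).const_mul
      (2 / Gamma (a + 1) * (1 / q))
    rw [mul_zero] at h1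
    refine squeeze_zero_norm' ?_ h1
    filter_upwards [eventually_ge_atTop 0] with w hw
    rw [Pi.mul_apply, norm_mul, norm_mul, norm_of_nonneg (exp_nonneg _), norm_div, norm_neg,
      norm_one, norm_of_nonneg hq.le]
    calc _ ≤ (2 / Gamma (a + 1) * w ^ a) * (1 / q * exp (-(w * q))) := by
          gcongr
          exact hub w hw
      _ = _ := by
        rw [show -(w * q) = -q * w by ring]
        ring)
  rw [h]
  have : ∫ w in Ioi (0 : ℝ), gammaWeight a w * (-1 / q * exp (-(w * q)))
      = -1 / q * (1 + q) ^ (-a) := by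
    rw [← hW.2, ← integral_const_mul]
    refine integral_congr_ae (Eventually.of_forall fun w => ?_)
    simp only
    ring
  rw [this]
  ring

end BracketKernels

section Integrability

open Set Filter Topology Real Module

lemma one_add_norm_sq_le {E : Type*} [NormedAddCommGroup E] (n y : E) :
    1 + ‖y‖ ^ 2 ≤ 2 * (1 + ‖n‖ ^ 2) * (1 + ‖n - y‖ ^ 2) := by
  have h : ‖y‖ ≤ ‖n‖ + ‖n - y‖ := by
    have := norm_sub_le n (n - y)
    rwa [sub_sub_cancel] at this
  have h2 : ‖y‖ ^ 2 ≤ (‖n‖ + ‖n - y‖) ^ 2 := by gcongr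
  nlinarith [sq_nonneg (‖n‖ - ‖n - y‖), mul_nonneg (sq_nonneg ‖n‖) (sq_nonneg ‖n - y‖)]

variable {E : Type*} [NormedAddCommGroup E] [InnerProductSpace ℝ E] [FiniteDimensional ℝ E]
  [MeasurableSpace E] [BorelSpace E]

lemma integrable_bracket_rpow_mul_norm_rpow (n : E) {a s : ℝ} (ha : 0 ≤ a) (hs : 0 ≤ s)
    (hsd : 2 * s < finrank ℝ E) (has : finrank ℝ E < 2 * (a + s)) :
    Integrable fun x : E => (1 + ‖x‖ ^ 2) ^ (-a) * ‖n - x‖ ^ (-(2 * s)) := by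
  suffices h : Integrable fun y : E => (1 + ‖n - y‖ ^ 2) ^ (-a) * ‖y‖ ^ (-(2 * s)) by
    simpa using h.comp_sub_left n
  have hd : 1 ≤ finrank ℝ E := by
    have : (0 : ℝ) < finrank ℝ E := by linarith
    exact_mod_cast this
  have h0 : IntegrableOn (fun y : E => ‖y‖ ^ (-(2 * s))) (Metric.closedBall 0 1) :=
    (locallyIntegrable_of_norm_le_rpow (C := 1) (α := 2 * s) hd hsd
      (Eventually.of_forall fun y => by rw [norm_of_nonneg (by positivity), one_mul])
      (by apply Measurable.aestronglyMeasurable; fun_prop)).integrableOn_isCompact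
      (isCompact_closedBall 0 1)
  have h1 : Integrable fun y : E => (1 + ‖y‖ ^ 2) ^ (-(2 * (a + s)) / 2) :=
    integrable_rpow_neg_one_add_norm_sq has
  set C : ℝ := (2 * (1 + ‖n‖ ^ 2)) ^ a with hC
  refine Integrable.mono' ((h0.integrable_indicator Metric.isClosed_closedBall.measurableSet).add
    (h1.const_mul (C * 2 ^ s))) (by apply Measurable.aestronglyMeasurable; fun_prop)
    (Eventually.of_forall fun y => ?_)
  have hb1 : (1 + ‖n - y‖ ^ 2) ^ (-a) ≤ 1 :=
    rpow_le_one_of_one_le_of_nonpos (by nlinarith [sq_nonneg ‖n - y‖]) (by linarith)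
  rw [norm_of_nonneg (by positivity)]
  by_cases hy : y ∈ Metric.closedBall (0 : E) 1
  · simp only [Pi.add_apply, indicator_of_mem hy]
    have : (1 + ‖n - y‖ ^ 2) ^ (-a) * ‖y‖ ^ (-(2 * s)) ≤ 1 * ‖y‖ ^ (-(2 * s)) := by gcongr
    have : 0 ≤ C * 2 ^ s * (1 + ‖y‖ ^ 2) ^ (-(2 * (a + s)) / 2) := by positivity
    linarith
  · simp only [Pi.add_apply, indicator_of_notMem hy, zero_add]
    have hy1 : 1 < ‖y‖ := by simpa using hy
    have hb2 : (1 + ‖n - y‖ ^ 2) ^ (-a) ≤ C * (1 + ‖y‖ ^ 2) ^ (-a) := by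
      have : (1 + ‖y‖ ^ 2) ^ a ≤ C * (1 + ‖n - y‖ ^ 2) ^ a := by
        rw [hC, ← mul_rpow (by positivity) (by positivity)]
        gcongr
        exact one_add_norm_sq_le n y
      rw [rpow_neg (by positivity), rpow_neg (by positivity), inv_eq_one_div, ← div_eq_mul_inv,
        div_le_div_iff₀ (by positivity) (by positivity)]
      linarith
    have hb3 : ‖y‖ ^ (-(2 * s)) ≤ 2 ^ s * (1 + ‖y‖ ^ 2) ^ (-s) := by
      have : (1 + ‖y‖ ^ 2) ^ s ≤ 2 ^ s * (‖y‖ ^ 2) ^ s := by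
        rw [← mul_rpow (by positivity) (by positivity)]
        gcongr
        nlinarith
      rw [show ‖y‖ ^ (-(2 * s)) = (‖y‖ ^ 2) ^ (-s) by
        rw [← rpow_natCast, ← rpow_mul (by positivity)]; push_cast; ring_nf]
      have hp : 0 < ‖y‖ ^ 2 := by positivity
      rw [rpow_neg (by positivity), rpow_neg (by positivity), inv_eq_one_div, ← div_eq_mul_inv,
        div_le_div_iff₀ (by positivity) (by positivity)]
      linarith
    calc _ ≤ (C * (1 + ‖y‖ ^ 2) ^ (-a)) * (2 ^ s * (1 + ‖y‖ ^ 2) ^ (-s)) := by gcongr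
      _ = C * 2 ^ s * ((1 + ‖y‖ ^ 2) ^ (-a) * (1 + ‖y‖ ^ 2) ^ (-s)) := by ring
      _ = _ := by
        rw [← rpow_add (by positivity)]
        congr 2
        ring

lemma exists_pow_mul_exp_neg_le {b : ℝ} (hb : 0 < b) (m : ℕ) :
    ∃ C : ℝ, ∀ q : ℝ, 0 ≤ q → (1 + q) ^ m * exp (-(b * q)) ≤ C := by
  refine ⟨m.factorial / b ^ m * exp b, fun q hq => ?_⟩
  have h := pow_div_factorial_le_exp (b * (1 + q)) (by positivity) m
  have hm : (0 : ℝ) < m.factorial := by exact_mod_cast m.factorial_pos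
  rw [div_le_iff₀ hm, mul_pow] at h
  have h2 : (1 + q) ^ m ≤ m.factorial / b ^ m * exp (b * (1 + q)) := by
    rw [div_mul_eq_mul_div, le_div_iff₀ (by positivity)]
    linarith
  calc _ ≤ m.factorial / b ^ m * exp (b * (1 + q)) * exp (-(b * q)) := by gcongr
    _ = m.factorial / b ^ m * (exp (b * (1 + q)) * exp (-(b * q))) := by ring
    _ = _ := by
      rw [← exp_add]
      ring_nf

lemma integrable_exp_neg_mul_norm_rpow_mul (n : E) {b s : ℝ} (hb : 0 < b) (hs : 0 ≤ s)
    (hsd : 2 * s < finrank ℝ E) {Q : E → ℝ} (hQ : Measurable Q) {C : ℝ} {p : ℕ}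
    (hQC : ∀ x, |Q x| ≤ C * (1 + ‖x‖ ^ 2) ^ p) :
    Integrable fun x : E => exp (-(b * ‖x‖ ^ 2)) * (‖n - x‖ ^ (-(2 * s)) * Q x) := by
  have hC : 0 ≤ C := by
    have := (abs_nonneg _).trans (hQC 0)
    simpa using this
  obtain ⟨C', hC'⟩ := exists_pow_mul_exp_neg_le hb (p + finrank ℝ E)
  refine Integrable.mono' ((integrable_bracket_rpow_mul_norm_rpow n (a := finrank ℝ E)
    (by positivity) hs hsd (by nlinarith)).const_mul (C * C'))
    (by apply Measurable.aestronglyMeasurable; fun_prop) (Eventually.of_forall fun x => ?_)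
  rw [norm_mul, norm_mul, norm_of_nonneg (exp_nonneg _), norm_eq_abs (Q x),
    norm_of_nonneg (by positivity : 0 ≤ ‖n - x‖ ^ (-(2 * s)))]
  have h2 : (1 + ‖x‖ ^ 2) ^ p * exp (-(b * ‖x‖ ^ 2))
      ≤ C' * (1 + ‖x‖ ^ 2) ^ (-(finrank ℝ E : ℝ)) := by
    rw [rpow_neg (by positivity), rpow_natCast, ← div_eq_mul_inv, le_div_iff₀ (by positivity)]
    have := hC' (‖x‖ ^ 2) (by positivity)
    rw [pow_add] at this
    linarith
  calc _ ≤ exp (-(b * ‖x‖ ^ 2)) * (‖n - x‖ ^ (-(2 * s)) * (C * (1 + ‖x‖ ^ 2) ^ p)) := by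
        gcongr
        exact hQC x
    _ = C * ((1 + ‖x‖ ^ 2) ^ p * exp (-(b * ‖x‖ ^ 2))) * ‖n - x‖ ^ (-(2 * s)) := by ring
    _ ≤ C * (C' * (1 + ‖x‖ ^ 2) ^ (-(finrank ℝ E : ℝ))) * ‖n - x‖ ^ (-(2 * s)) := by gcongr
    _ = _ := by ring

lemma integrable_exp_neg_mul {b : ℝ} (hb : 0 < b) (hd : 0 < finrank ℝ E)
    {Q : E → ℝ} (hQ : Measurable Q) {C : ℝ} {p : ℕ}
    (hQC : ∀ x, |Q x| ≤ C * (1 + ‖x‖ ^ 2) ^ p) :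
    Integrable fun x : E => exp (-(b * ‖x‖ ^ 2)) * Q x := by
  have hd' : (0 : ℝ) < finrank ℝ E := by exact_mod_cast hd
  simpa using integrable_exp_neg_mul_norm_rpow_mul 0 hb le_rfl (by linarith) hQ hQC

end Integrability

section GaussianMoments

open Set Filter Topology Real Module

lemma abs_inner_sq_le {E : Type*} [NormedAddCommGroup E] [InnerProductSpace ℝ E]
    (v x : E) : |⟪v, x⟫ ^ 2| ≤ ‖v‖ ^ 2 * (1 + ‖x‖ ^ 2) ^ 1 := by
  have h := abs_real_inner_le_norm v x
  rw [abs_pow, pow_one]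
  calc |⟪v, x⟫| ^ 2 ≤ (‖v‖ * ‖x‖) ^ 2 := by gcongr
    _ = ‖v‖ ^ 2 * ‖x‖ ^ 2 := by ring
    _ ≤ _ := by gcongr; linarith

lemma abs_inner_mul_inner_sq_le {E : Type*} [NormedAddCommGroup E] [InnerProductSpace ℝ E]
    {n v : E} (hv : ‖v‖ = 1) (x : E) :
    |⟪n, x⟫ * ⟪v, x⟫ ^ 2| ≤ ‖n‖ * (1 + ‖x‖ ^ 2) ^ 2 := by
  have h1 := abs_real_inner_le_norm n x
  have h2 := abs_inner_sq_le v x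
  rw [hv, one_pow, one_mul, pow_one] at h2
  have h3 : ‖x‖ ≤ 1 + ‖x‖ ^ 2 := by nlinarith [sq_nonneg (‖x‖ - 1), sq_nonneg ‖x‖]
  rw [abs_mul]
  calc _ ≤ (‖n‖ * (1 + ‖x‖ ^ 2)) * (1 + ‖x‖ ^ 2) := by
        gcongr
        exact h1.trans (by gcongr)
    _ = _ := by ring

variable {E : Type*} [NormedAddCommGroup E] [InnerProductSpace ℝ E] [FiniteDimensional ℝ E]
  [MeasurableSpace E] [BorelSpace E]

lemma integral_exp_neg_mul_norm_sq [Nontrivial E] {b : ℝ} (hb : 0 < b) :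
    ∫ x : E, exp (-(b * ‖x‖ ^ 2)) * ‖x‖ ^ 2
      = finrank ℝ E * (π ^ ((finrank ℝ E : ℝ) / 2) / 2 * b ^ (-(finrank ℝ E : ℝ) / 2 - 1)) := by
  have hd : 0 < finrank ℝ E := finrank_pos
  rw [integral_fun_norm_addHaar volume (fun r : ℝ => exp (-(b * r ^ 2)) * r ^ 2)]
  have hI : ∫ y in Ioi (0 : ℝ), y ^ (finrank ℝ E - 1) • (exp (-(b * y ^ 2)) * y ^ 2)
      = ∫ y in Ioi (0 : ℝ), y ^ ((finrank ℝ E : ℝ) + 1) * exp (-b * y ^ (2 : ℝ)) := by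
    refine setIntegral_congr_fun measurableSet_Ioi fun y hy => ?_
    have : (finrank ℝ E : ℝ) + 1 = ((finrank ℝ E - 1 + 2 : ℕ) : ℝ) := by
      have : finrank ℝ E - 1 + 2 = finrank ℝ E + 1 := by omega
      rw [this]
      push_cast
      rfl
    simp only [smul_eq_mul]
    rw [this, rpow_natCast, pow_add, rpow_two, neg_mul]
    ring
  rw [hI, integral_rpow_mul_exp_neg_mul_rpow two_pos (by linarith [(Nat.cast_nonneg (finrank ℝ E) :
    (0 : ℝ) ≤ finrank ℝ E)]) hb, Measure.real, InnerProductSpace.volume_ball]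
  have hΓ : 0 < Gamma ((finrank ℝ E : ℝ) / 2 + 1) := Gamma_pos_of_pos (by positivity)
  have hπ : √π ^ finrank ℝ E = π ^ ((finrank ℝ E : ℝ) / 2) := by
    rw [sqrt_eq_rpow, ← rpow_mul_natCast pi_nonneg]
    ring_nf
  rw [ENNReal.ofReal_one, one_pow, one_mul, ENNReal.toReal_ofReal (by positivity), hπ,
    show ((finrank ℝ E : ℝ) + 1 + 1) / 2 = (finrank ℝ E : ℝ) / 2 + 1 by ring,
    show -((finrank ℝ E : ℝ) + 1 + 1) / 2 = -(finrank ℝ E : ℝ) / 2 - 1 by ring]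
  simp only [nsmul_eq_mul, smul_eq_mul]
  field_simp

lemma integral_exp_neg_mul_inner_sq {b : ℝ} (hb : 0 < b) {v : E} (hv : ‖v‖ = 1) :
    ∫ x : E, exp (-(b * ‖x‖ ^ 2)) * ⟪v, x⟫ ^ 2
      = π ^ ((finrank ℝ E : ℝ) / 2) / 2 * b ^ (-(finrank ℝ E : ℝ) / 2 - 1) := by
  have hv0 : v ≠ 0 := by
    rintro rfl
    simp at hv
  have : Nontrivial E := ⟨v, 0, hv0⟩
  have hd : 0 < finrank ℝ E := finrank_pos
  have hrot : ∀ u : E, ‖u‖ = 1 → ∫ x : E, exp (-(b * ‖x‖ ^ 2)) * ⟪u, x⟫ ^ 2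
      = ∫ x : E, exp (-(b * ‖x‖ ^ 2)) * ⟪v, x⟫ ^ 2 := by
    intro u hu
    set T := (ℝ ∙ (v - u))ᗮ.reflection with hT
    have hTv : T v = u := Submodule.reflection_sub (hv.trans hu.symm)
    have h := T.measurePreserving.integral_comp T.toHomeomorph.measurableEmbedding
      (fun x : E => exp (-(b * ‖x‖ ^ 2)) * ⟪u, x⟫ ^ 2)
    rw [← h]
    refine integral_congr_ae (Eventually.of_forall fun x => ?_)
    simp only [LinearIsometryEquiv.norm_map]
    rw [← hTv, LinearIsometryEquiv.inner_map_map]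
  set B := stdOrthonormalBasis ℝ E with hB
  have hsum : ∫ x : E, exp (-(b * ‖x‖ ^ 2)) * ‖x‖ ^ 2
      = ∑ i, ∫ x : E, exp (-(b * ‖x‖ ^ 2)) * ⟪B i, x⟫ ^ 2 := by
    rw [← integral_finsetSum _ fun i _ => integrable_exp_neg_mul hb hd (by fun_prop)
      (abs_inner_sq_le (B i))]
    refine integral_congr_ae (Eventually.of_forall fun x => ?_)
    simp only
    rw [← Finset.mul_sum, ← B.sum_sq_norm_inner_right x]
    simp only [norm_eq_abs, sq_abs]
  rw [integral_exp_neg_mul_norm_sq hb, Finset.sum_congr rfl fun i _ => hrot (B i) (B.norm_eq_one i),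
    Finset.sum_const, Finset.card_univ, Fintype.card_fin, nsmul_eq_mul] at hsum
  have hd' : (finrank ℝ E : ℝ) ≠ 0 := by exact_mod_cast hd.ne'
  exact (mul_left_cancel₀ hd' hsum).symm

/-- Completing the square in a product of two Gaussians. -/
lemma integral_gaussian_mul_gaussian (n : E) {w u : ℝ} (hw : 0 < w) (hu : 0 < u) (Q : E → ℝ) :
    ∫ x : E, exp (-(u * ‖n - x‖ ^ 2)) * (exp (-(w * ‖x‖ ^ 2)) * Q x)
      = exp (-(w * (‖n‖ ^ 2 * (u / (w + u))))) *
        ∫ y : E, exp (-((w + u) * ‖y‖ ^ 2)) * Q (y + (u / (w + u)) • n) := by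
  rw [← integral_add_right_eq_self _ ((u / (w + u)) • n), ← integral_const_mul]
  refine integral_congr_ae (Eventually.of_forall fun y => ?_)
  simp only
  rw [← mul_assoc, ← mul_assoc, ← exp_add, ← exp_add]
  congr 2
  have h1 : n - (y + (u / (w + u)) • n) = (w / (w + u)) • n - y := by
    have : w / (w + u) = 1 - u / (w + u) := by
      field_simp
      ring
    rw [this, sub_smul, one_smul]
    abel
  rw [h1, norm_sub_sq_real, norm_add_sq_real, norm_smul, norm_smul, real_inner_smul_left,
    real_inner_smul_right, real_inner_comm n y, norm_of_nonneg (by positivity : 0 ≤ w / (w + u)),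
    norm_of_nonneg (by positivity : 0 ≤ u / (w + u))]
  field_simp
  ring

variable {n v : E} {w u : ℝ}

lemma integral_gaussian_mul_inner_sq (hv : ‖v‖ = 1) (hvn : ⟪v, n⟫ = 0) (hw : 0 < w) (hu : 0 < u) :
    ∫ x : E, exp (-(u * ‖n - x‖ ^ 2)) * (exp (-(w * ‖x‖ ^ 2)) * ⟪v, x⟫ ^ 2)
      = π ^ ((finrank ℝ E : ℝ) / 2) / 2 * (w + u) ^ (-(finrank ℝ E : ℝ) / 2 - 1) *
        exp (-(w * (‖n‖ ^ 2 * (u / (w + u))))) := by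
  rw [integral_gaussian_mul_gaussian n hw hu]
  simp only [inner_add_right, real_inner_smul_right, hvn, mul_zero, add_zero]
  rw [integral_exp_neg_mul_inner_sq (by positivity) hv]
  ring

lemma integral_exp_neg_mul_transverse (hn : n ≠ 0) (hw : 0 < w) :
    ∫ x : E, exp (-(w * ‖x‖ ^ 2)) * (‖n‖ ^ 2 * ‖x‖ ^ 2 - ⟪n, x⟫ ^ 2)
      = ‖n‖ ^ 2 * (finrank ℝ E - 1) *
        (π ^ ((finrank ℝ E : ℝ) / 2) / 2 * w ^ (-(finrank ℝ E : ℝ) / 2 - 1)) := by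
  have : Nontrivial E := ⟨n, 0, hn⟩
  have hd : 0 < finrank ℝ E := finrank_pos
  have hn' : ‖n‖ ≠ 0 := norm_ne_zero_iff.2 hn
  have e : ∀ x : E, exp (-(w * ‖x‖ ^ 2)) * (‖n‖ ^ 2 * ‖x‖ ^ 2 - ⟪n, x⟫ ^ 2)
      = ‖n‖ ^ 2 * (exp (-(w * ‖x‖ ^ 2)) * ‖x‖ ^ 2)
        - ‖n‖ ^ 2 * (exp (-(w * ‖x‖ ^ 2)) * ⟪‖n‖⁻¹ • n, x⟫ ^ 2) := by
    intro x
    rw [real_inner_smul_left]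
    field_simp
  have hi1 : Integrable fun x : E => exp (-(w * ‖x‖ ^ 2)) * ‖x‖ ^ 2 :=
    integrable_exp_neg_mul hw hd (C := 1) (p := 1) (by fun_prop) fun x => by
      rw [abs_of_nonneg (by positivity)]
      linarith
  have hi2 : Integrable fun x : E => exp (-(w * ‖x‖ ^ 2)) * ⟪‖n‖⁻¹ • n, x⟫ ^ 2 :=
    integrable_exp_neg_mul hw hd (by fun_prop) (abs_inner_sq_le _)
  simp only [e]
  rw [integral_sub (hi1.const_mul _) (hi2.const_mul _), integral_const_mul, integral_const_mul,
    integral_exp_neg_mul_norm_sq hw, integral_exp_neg_mul_inner_sq hw (by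
      rw [norm_smul, norm_inv, norm_norm, inv_mul_cancel₀ hn'])]
  ring

lemma integral_gaussian_mul_transverse (hn : n ≠ 0) (hw : 0 < w) (hu : 0 < u) :
    ∫ x : E, exp (-(u * ‖n - x‖ ^ 2)) *
        (exp (-(w * ‖x‖ ^ 2)) * (‖n‖ ^ 2 * ‖x‖ ^ 2 - ⟪n, x⟫ ^ 2))
      = ‖n‖ ^ 2 * (finrank ℝ E - 1) *
        (π ^ ((finrank ℝ E : ℝ) / 2) / 2 * (w + u) ^ (-(finrank ℝ E : ℝ) / 2 - 1)) *
        exp (-(w * (‖n‖ ^ 2 * (u / (w + u))))) := by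
  rw [integral_gaussian_mul_gaussian n hw hu]
  have e : ∀ y : E, ‖n‖ ^ 2 * ‖y + (u / (w + u)) • n‖ ^ 2 - ⟪n, y + (u / (w + u)) • n⟫ ^ 2
      = ‖n‖ ^ 2 * ‖y‖ ^ 2 - ⟪n, y⟫ ^ 2 := by
    intro y
    rw [norm_add_sq_real, norm_smul, inner_add_right, real_inner_smul_right, real_inner_smul_right,
      real_inner_self_eq_norm_sq, real_inner_comm n y, mul_pow, norm_eq_abs, sq_abs]
    ring
  simp only [e]
  rw [integral_exp_neg_mul_transverse hn (by positivity)]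
  ring

lemma integral_gaussian_mul_inner_mul_inner_sq (hv : ‖v‖ = 1) (hvn : ⟪v, n⟫ = 0) (hw : 0 < w)
    (hu : 0 < u) :
    ∫ x : E, exp (-(u * ‖n - x‖ ^ 2)) * (exp (-(w * ‖x‖ ^ 2)) * (⟪n, x⟫ * ⟪v, x⟫ ^ 2))
      = ‖n‖ ^ 2 * (u / (w + u)) *
        (π ^ ((finrank ℝ E : ℝ) / 2) / 2 * (w + u) ^ (-(finrank ℝ E : ℝ) / 2 - 1)) *
        exp (-(w * (‖n‖ ^ 2 * (u / (w + u))))) := by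
  have hv0 : v ≠ 0 := by
    rintro rfl
    simp at hv
  have : Nontrivial E := ⟨v, 0, hv0⟩
  have hd : 0 < finrank ℝ E := finrank_pos
  have hb : 0 < w + u := by positivity
  rw [integral_gaussian_mul_gaussian n hw hu]
  have e : ∀ y : E, exp (-((w + u) * ‖y‖ ^ 2)) *
      (⟪n, y + (u / (w + u)) • n⟫ * ⟪v, y + (u / (w + u)) • n⟫ ^ 2)
      = exp (-((w + u) * ‖y‖ ^ 2)) * (⟪n, y⟫ * ⟪v, y⟫ ^ 2)
        + ‖n‖ ^ 2 * (u / (w + u)) * (exp (-((w + u) * ‖y‖ ^ 2)) * ⟪v, y⟫ ^ 2) := by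
    intro y
    rw [inner_add_right, inner_add_right, real_inner_smul_right, real_inner_smul_right,
      real_inner_self_eq_norm_sq, hvn]
    ring
  simp only [e]
  have hodd : ∫ y : E, exp (-((w + u) * ‖y‖ ^ 2)) * (⟪n, y⟫ * ⟪v, y⟫ ^ 2) = 0 := by
    have h := integral_neg_eq_self
      (fun y : E => exp (-((w + u) * ‖y‖ ^ 2)) * (⟪n, y⟫ * ⟪v, y⟫ ^ 2)) volume
    simp only [norm_neg, inner_neg_right, neg_sq, neg_mul, mul_neg, integral_neg] at h
    linarith
  rw [integral_add (integrable_exp_neg_mul hb hd (by fun_prop) (abs_inner_mul_inner_sq_le hv))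
    ((integrable_exp_neg_mul hb hd (by fun_prop) (abs_inner_sq_le _)).const_mul _), hodd,
    integral_const_mul, integral_exp_neg_mul_inner_sq hb hv]
  ring

end GaussianMoments

section Subordination

open Set Filter Topology Real Module

lemma integral_rpow_mul_add_rpow_mul {w s h : ℝ} (hw : 0 < w) (hsh : s < h) (θ : ℝ → ℝ) :
    ∫ u in Ioi (0 : ℝ), u ^ (s - 1) * ((w + u) ^ (-h - 1) * θ (u / (w + u)))
      = w ^ (s - h - 1) * ∫ z in Ioi (0 : ℝ), z ^ (s - 1) * max (1 - z) 0 ^ (h - s) * θ z := by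
  have himg : (fun z : ℝ => w * z / (1 - z)) '' Ioo 0 1 = Ioi 0 := by
    ext u
    constructor
    · rintro ⟨z, ⟨hz0, hz1⟩, rfl⟩
      exact div_pos (mul_pos hw hz0) (by linarith)
    · intro hu
      have hu : 0 < u := hu
      refine ⟨u / (w + u), ⟨by positivity, (div_lt_one (by positivity)).2 (by linarith)⟩, ?_⟩
      simp only
      field_simp
      rw [div_eq_iff (by linarith)]
      ring
  have hderiv : ∀ z ∈ Ioo (0 : ℝ) 1,
      HasDerivWithinAt (fun z : ℝ => w * z / (1 - z)) (w / (1 - z) ^ 2) (Ioo 0 1) z := by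
    intro z hz
    have h1 : (1 - z) ≠ 0 := by linarith [hz.2]
    have := (((hasDerivAt_id z).const_mul w).div ((hasDerivAt_id z).const_sub 1) h1)
    refine (this.congr_deriv ?_).hasDerivWithinAt
    simp only [id]
    ring
  have hinj : InjOn (fun z : ℝ => w * z / (1 - z)) (Ioo 0 1) := by
    intro x hx y hy hxy
    have hx1 : (1 - x) ≠ 0 := by linarith [hx.2]
    have hy1 : (1 - y) ≠ 0 := by linarith [hy.2]
    simp only at hxy
    rw [div_eq_div_iff hx1 hy1] at hxy
    have : w * (x - y) = 0 := by linarith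
    rcases mul_eq_zero.1 this with h | h <;> linarith
  rw [← himg, integral_image_eq_integral_abs_deriv_smul measurableSet_Ioo hderiv hinj, himg,
    ← integral_const_mul]
  have hI : ∫ z in Ioi (0 : ℝ),
      w ^ (s - h - 1) * (z ^ (s - 1) * max (1 - z) 0 ^ (h - s) * θ z)
      = ∫ z in Ioo (0 : ℝ) 1, w ^ (s - h - 1) * (z ^ (s - 1) * max (1 - z) 0 ^ (h - s) * θ z) := by
    refine (setIntegral_eq_of_subset_of_forall_sdiff_eq_zero measurableSet_Ioi
      (fun z hz => hz.1) fun z hz => ?_)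
    have : 1 - z ≤ 0 := by
      by_contra hc
      exact hz.2 ⟨hz.1, by linarith⟩
    rw [max_eq_right this, zero_rpow (by linarith)]
    ring
  rw [hI]
  refine setIntegral_congr_fun measurableSet_Ioo fun z hz => ?_
  have hz0 : 0 < z := hz.1
  have hz1 : 0 < 1 - z := by linarith [hz.2]
  have hwz : w + w * z / (1 - z) = w / (1 - z) := by
    field_simp
    ring
  have hq : w * z / (1 - z) / (w / (1 - z)) = z := by field_simp
  have hpow : (1 - z) ^ (h - s)
      = ((1 - z) ^ 2)⁻¹ / (1 - z) ^ (s - 1) / (1 - z) ^ (-h - 1) := by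
    rw [← rpow_two, ← rpow_neg hz1.le, ← rpow_sub hz1, ← rpow_sub hz1]
    ring_nf
  simp only [smul_eq_mul]
  rw [hwz, hq, max_eq_left hz1.le, abs_of_pos (by positivity), div_rpow (by positivity) hz1.le,
    div_rpow hw.le hz1.le, mul_rpow hw.le hz0.le,
    show s - h - 1 = 1 + (s - 1) + (-h - 1) by ring, rpow_add hw, rpow_add hw, rpow_one, hpow]
  field_simp

variable {E : Type*} [NormedAddCommGroup E] [InnerProductSpace ℝ E] [FiniteDimensional ℝ E]
  [MeasurableSpace E] [BorelSpace E]

lemma integral_exp_neg_mul_norm_rpow_mul {n : E} {Q : E → ℝ} (hQ : Measurable Q) {C : ℝ} {p : ℕ}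
    (hQC : ∀ x, |Q x| ≤ C * (1 + ‖x‖ ^ 2) ^ p) {A B w s : ℝ} (hw : 0 < w) (hs : 0 < s)
    (hsd : 2 * s < finrank ℝ E)
    (hQe : ∀ u, 0 < u → ∫ x : E, exp (-(u * ‖n - x‖ ^ 2)) * (exp (-(w * ‖x‖ ^ 2)) * Q x)
      = π ^ ((finrank ℝ E : ℝ) / 2) / 2 * (w + u) ^ (-(finrank ℝ E : ℝ) / 2 - 1)
        * (A + B * (u / (w + u))) * exp (-(w * (‖n‖ ^ 2 * (u / (w + u)))))) :
    ∫ x : E, exp (-(w * ‖x‖ ^ 2)) * (‖n - x‖ ^ (-(2 * s)) * Q x)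
      = π ^ ((finrank ℝ E : ℝ) / 2) / (2 * Gamma s) * w ^ (s - (finrank ℝ E : ℝ) / 2 - 1)
        * ∫ z in Ioi (0 : ℝ), exp (-(w * (‖n‖ ^ 2 * z)))
          * (z ^ (s - 1) * max (1 - z) 0 ^ ((finrank ℝ E : ℝ) / 2 - s) * (A + B * z)) := by
  have hΓ : 0 < Gamma s := Gamma_pos_of_pos hs
  have hE : Nontrivial E := (finrank_pos_iff (R := ℝ)).1 (by
    have : (0 : ℝ) < finrank ℝ E := by linarith
    exact_mod_cast this)
  have hK : ∀ᵐ x : E, IntegrableOn (fun u => u ^ (s - 1) * exp (-(u * ‖n - x‖ ^ 2))) (Ioi 0) ∧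
      ∫ u in Ioi (0 : ℝ), u ^ (s - 1) * exp (-(u * ‖n - x‖ ^ 2))
        = Gamma s * ‖n - x‖ ^ (-(2 * s)) := by
    filter_upwards [compl_mem_ae_iff.2 (measure_singleton n)] with x hx
    have hr : 0 < ‖n - x‖ := norm_pos_iff.2 (sub_ne_zero.2 (Ne.symm hx))
    have hr2 : 0 < ‖n - x‖ ^ 2 := by positivity
    have hc : (fun u : ℝ => u ^ (s - 1) * exp (-(u * ‖n - x‖ ^ 2)))
        = fun u => u ^ (s - 1) * exp (-(‖n - x‖ ^ 2 * u)) := by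
      funext u
      rw [mul_comm u (‖n - x‖ ^ 2)]
    rw [hc]
    refine ⟨integrableOn_rpow_mul_exp_neg_mul hs hr2, ?_⟩
    rw [integral_rpow_mul_exp_neg_mul_Ioi hs hr2, one_div, ← rpow_natCast, inv_rpow (by positivity),
      ← rpow_mul hr.le, rpow_neg hr.le]
    push_cast
    ring
  have hFint := integrable_exp_neg_mul_norm_rpow_mul n hw hs.le hsd hQ hQC
  obtain ⟨-, h⟩ := integrable_integral_laplace (volume : Measure E) (m := fun u => u ^ (s - 1))
    (by fun_prop) (fun u hu => rpow_nonneg hu.le _) (ρ := fun x => ‖n - x‖ ^ 2)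
    (F := fun x => exp (-(w * ‖x‖ ^ 2)) * Q x) (by fun_prop) (by fun_prop) hK
    ((hFint.const_mul (Gamma s)).congr (Eventually.of_forall fun x => by ring))
  have h2 : ∫ x : E, exp (-(w * ‖x‖ ^ 2)) * (‖n - x‖ ^ (-(2 * s)) * Q x)
      = 1 / Gamma s * ∫ x : E, Gamma s * ‖n - x‖ ^ (-(2 * s)) * (exp (-(w * ‖x‖ ^ 2)) * Q x) := by
    rw [← integral_const_mul]
    refine integral_congr_ae (Eventually.of_forall fun x => ?_)
    simp only
    field_simp
  rw [h2, h]
  have h3 : ∫ u in Ioi (0 : ℝ), u ^ (s - 1)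
        * ∫ x : E, exp (-(u * ‖n - x‖ ^ 2)) * (exp (-(w * ‖x‖ ^ 2)) * Q x)
      = π ^ ((finrank ℝ E : ℝ) / 2) / 2 * ∫ u in Ioi (0 : ℝ), u ^ (s - 1)
        * ((w + u) ^ (-((finrank ℝ E : ℝ) / 2) - 1) * (fun z =>
          (A + B * z) * exp (-(w * (‖n‖ ^ 2 * z)))) (u / (w + u))) := by
    rw [← integral_const_mul]
    refine setIntegral_congr_fun measurableSet_Ioi fun u hu => ?_
    simp only
    rw [hQe u hu, neg_div]
    ring
  rw [h3, integral_rpow_mul_add_rpow_mul hw (by linarith)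
    (fun z => (A + B * z) * exp (-(w * (‖n‖ ^ 2 * z))))]
  have h4 : ∀ z : ℝ, z ^ (s - 1) * max (1 - z) 0 ^ ((finrank ℝ E : ℝ) / 2 - s)
        * ((A + B * z) * exp (-(w * (‖n‖ ^ 2 * z))))
      = exp (-(w * (‖n‖ ^ 2 * z)))
          * (z ^ (s - 1) * max (1 - z) 0 ^ ((finrank ℝ E : ℝ) / 2 - s) * (A + B * z)) := by
    intro z
    ring
  simp only [h4]
  ring

end Subordination

section LaplaceTransforms

open Set Filter Topology Real Module

variable {E : Type*} [NormedAddCommGroup E] [InnerProductSpace ℝ E] [FiniteDimensional ℝ E]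
  [MeasurableSpace E] [BorelSpace E] {n v : E} {s w : ℝ}

lemma abs_transverse_le {E : Type*} [NormedAddCommGroup E] [InnerProductSpace ℝ E] (n x : E) :
    |‖n‖ ^ 2 * ‖x‖ ^ 2 - ⟪n, x⟫ ^ 2| ≤ ‖n‖ ^ 2 * ‖x‖ ^ 2 := by
  have h : ⟪n, x⟫ ^ 2 ≤ ‖n‖ ^ 2 * ‖x‖ ^ 2 := by
    rw [← sq_abs, ← mul_pow]
    gcongr
    exact abs_real_inner_le_norm n x
  rw [abs_of_nonneg (by linarith)]
  linarith [sq_nonneg ⟪n, x⟫]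

lemma integral_exp_neg_mul_norm_rpow_mul_inner_sq (hv : ‖v‖ = 1) (hvn : ⟪v, n⟫ = 0)
    (hw : 0 < w) (hs : 0 < s) (hsd : 2 * s < finrank ℝ E) :
    ∫ x : E, exp (-(w * ‖x‖ ^ 2)) * (‖n - x‖ ^ (-(2 * s)) * ⟪v, x⟫ ^ 2)
      = π ^ ((finrank ℝ E : ℝ) / 2) / (2 * Gamma s) * (w ^ (s - (finrank ℝ E : ℝ) / 2 - 1)
        * ∫ z in Ioi (0 : ℝ), exp (-(w * (‖n‖ ^ 2 * z)))
          * (z ^ (s - 1) * max (1 - z) 0 ^ ((finrank ℝ E : ℝ) / 2 - s))) := by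
  rw [integral_exp_neg_mul_norm_rpow_mul (n := n) (Q := fun x => ⟪v, x⟫ ^ 2) (by fun_prop)
    (abs_inner_sq_le v) (A := 1) (B := 0) hw hs hsd fun u hu => by
      rw [integral_gaussian_mul_inner_sq hv hvn hw hu]
      ring]
  simp only [zero_mul, add_zero, mul_one]
  ring

lemma integral_exp_neg_mul_norm_rpow_mul_inner_mul_inner_sq (hv : ‖v‖ = 1) (hvn : ⟪v, n⟫ = 0)
    (hw : 0 < w) (hs : 0 < s) (hsd : 2 * s < finrank ℝ E) :
    ∫ x : E, exp (-(w * ‖x‖ ^ 2)) * (‖n - x‖ ^ (-(2 * s)) * (⟪n, x⟫ * ⟪v, x⟫ ^ 2))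
      = π ^ ((finrank ℝ E : ℝ) / 2) / (2 * Gamma s) * ‖n‖ ^ 2
        * (w ^ (s - (finrank ℝ E : ℝ) / 2 - 1) * ∫ z in Ioi (0 : ℝ), exp (-(w * (‖n‖ ^ 2 * z)))
          * (z ^ s * max (1 - z) 0 ^ ((finrank ℝ E : ℝ) / 2 - s))) := by
  rw [integral_exp_neg_mul_norm_rpow_mul (n := n) (Q := fun x => ⟪n, x⟫ * ⟪v, x⟫ ^ 2) (by fun_prop)
    (abs_inner_mul_inner_sq_le hv) (A := 0) (B := ‖n‖ ^ 2) hw hs hsd fun u hu => by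
      rw [integral_gaussian_mul_inner_mul_inner_sq hv hvn hw hu]
      ring]
  have h : ∫ z in Ioi (0 : ℝ), exp (-(w * (‖n‖ ^ 2 * z)))
        * (z ^ (s - 1) * max (1 - z) 0 ^ ((finrank ℝ E : ℝ) / 2 - s) * (0 + ‖n‖ ^ 2 * z))
      = ‖n‖ ^ 2 * ∫ z in Ioi (0 : ℝ), exp (-(w * (‖n‖ ^ 2 * z)))
          * (z ^ s * max (1 - z) 0 ^ ((finrank ℝ E : ℝ) / 2 - s)) := by
    rw [← integral_const_mul]
    refine setIntegral_congr_fun measurableSet_Ioi fun z hz => ?_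
    have hz : 0 < z := hz
    rw [rpow_sub_one hz.ne']
    field_simp
    ring
  rw [h]
  ring

lemma integral_exp_neg_mul_sub_mul_transverse (hn : n ≠ 0) (hw : 0 < w) (hs : 0 < s)
    (hsd : 2 * s < finrank ℝ E) :
    ∫ x : E, exp (-(w * ‖x‖ ^ 2)) * ((‖n - x‖ ^ (-(2 * s)) - ‖n‖ ^ (-(2 * s)))
        * (‖n‖ ^ 2 * ‖x‖ ^ 2 - ⟪n, x⟫ ^ 2))
      = π ^ ((finrank ℝ E : ℝ) / 2) / (2 * Gamma s) * (‖n‖ ^ 2 * (finrank ℝ E - 1))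
        * (w ^ (s - (finrank ℝ E : ℝ) / 2 - 1) * ∫ z in Ioi (0 : ℝ), exp (-(w * (‖n‖ ^ 2 * z)))
          * (z ^ (s - 1) * (max (1 - z) 0 ^ ((finrank ℝ E : ℝ) / 2 - s) - 1))) := by
  have hn' : 0 < ‖n‖ := norm_pos_iff.2 hn
  have hΓ : 0 < Gamma s := Gamma_pos_of_pos hs
  have hd : 0 < finrank ℝ E := by
    have : (0 : ℝ) < finrank ℝ E := by linarith
    exact_mod_cast this
  have hQm : Measurable fun x : E => ‖n‖ ^ 2 * ‖x‖ ^ 2 - ⟪n, x⟫ ^ 2 := by fun_prop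
  have hQC : ∀ x : E, |‖n‖ ^ 2 * ‖x‖ ^ 2 - ⟪n, x⟫ ^ 2| ≤ ‖n‖ ^ 2 * (1 + ‖x‖ ^ 2) ^ 1 :=
    fun x => (abs_transverse_le n x).trans (by nlinarith [sq_nonneg ‖n‖])
  have i1 := integrable_exp_neg_mul_norm_rpow_mul n hw hs.le hsd hQm hQC
  have i2 := integrable_exp_neg_mul hw hd hQm hQC
  have e1 : ∀ x : E, exp (-(w * ‖x‖ ^ 2)) * ((‖n - x‖ ^ (-(2 * s)) - ‖n‖ ^ (-(2 * s)))
        * (‖n‖ ^ 2 * ‖x‖ ^ 2 - ⟪n, x⟫ ^ 2))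
      = exp (-(w * ‖x‖ ^ 2)) * (‖n - x‖ ^ (-(2 * s)) * (‖n‖ ^ 2 * ‖x‖ ^ 2 - ⟪n, x⟫ ^ 2))
        - ‖n‖ ^ (-(2 * s)) * (exp (-(w * ‖x‖ ^ 2)) * (‖n‖ ^ 2 * ‖x‖ ^ 2 - ⟪n, x⟫ ^ 2)) :=
    fun x => by ring
  simp only [e1]
  rw [integral_sub i1 (i2.const_mul _), integral_const_mul, integral_exp_neg_mul_transverse hn hw,
    integral_exp_neg_mul_norm_rpow_mul (n := n) hQm hQC (A := ‖n‖ ^ 2 * (finrank ℝ E - 1)) (B := 0)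
      hw hs hsd fun u hu => by
        rw [integral_gaussian_mul_transverse hn hw hu]
        ring]
  have hr : 0 < w * ‖n‖ ^ 2 := by positivity
  have j1 : IntegrableOn (fun z : ℝ => exp (-(w * (‖n‖ ^ 2 * z))) * z ^ (s - 1)) (Ioi 0) :=
    (integrableOn_rpow_mul_exp_neg_mul hs hr).congr_fun
      (fun z _ => by simp only; rw [mul_comm, mul_assoc w]) measurableSet_Ioi
  have v1 : ∫ z in Ioi (0 : ℝ), exp (-(w * (‖n‖ ^ 2 * z))) * z ^ (s - 1)
      = w ^ (-s) * ‖n‖ ^ (-(2 * s)) * Gamma s := by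
    have : ∫ z in Ioi (0 : ℝ), exp (-(w * (‖n‖ ^ 2 * z))) * z ^ (s - 1)
        = ∫ z in Ioi (0 : ℝ), z ^ (s - 1) * exp (-((w * ‖n‖ ^ 2) * z)) :=
      setIntegral_congr_fun measurableSet_Ioi
        fun z _ => by rw [mul_comm, mul_assoc w]
    rw [this, integral_rpow_mul_exp_neg_mul_Ioi hs hr, one_div, inv_rpow hr.le,
      mul_rpow hw.le (by positivity), rpow_neg hw.le, rpow_neg hn'.le, ← rpow_natCast,
      ← rpow_mul hn'.le]
    push_cast
    rw [mul_inv]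
  have j2 : IntegrableOn (fun z : ℝ => exp (-(w * (‖n‖ ^ 2 * z)))
      * (z ^ (s - 1) * max (1 - z) 0 ^ ((finrank ℝ E : ℝ) / 2 - s))) (Ioi 0) := by
    refine Integrable.mono' j1 (by apply Measurable.aestronglyMeasurable; fun_prop) ?_
    filter_upwards [ae_restrict_mem measurableSet_Ioi] with z hz
    have hz : 0 < z := hz
    have h1 : max (1 - z) 0 ^ ((finrank ℝ E : ℝ) / 2 - s) ≤ 1 :=
      rpow_le_one (le_max_right _ _) (max_le (by linarith) zero_le_one) (by linarith)
    have h0 : 0 ≤ max (1 - z) 0 ^ ((finrank ℝ E : ℝ) / 2 - s) := rpow_nonneg (le_max_right _ _) _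
    rw [norm_of_nonneg (by positivity)]
    have : 0 ≤ exp (-(w * (‖n‖ ^ 2 * z))) * z ^ (s - 1) := by positivity
    nlinarith
  have e2 : ∀ z : ℝ, exp (-(w * (‖n‖ ^ 2 * z)))
          * (z ^ (s - 1) * (max (1 - z) 0 ^ ((finrank ℝ E : ℝ) / 2 - s) - 1))
      = exp (-(w * (‖n‖ ^ 2 * z))) * (z ^ (s - 1) * max (1 - z) 0 ^ ((finrank ℝ E : ℝ) / 2 - s))
        - exp (-(w * (‖n‖ ^ 2 * z))) * z ^ (s - 1) := fun z => by ring
  have e3 : ∀ z : ℝ, exp (-(w * (‖n‖ ^ 2 * z)))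
          * (z ^ (s - 1) * max (1 - z) 0 ^ ((finrank ℝ E : ℝ) / 2 - s)
            * (‖n‖ ^ 2 * (finrank ℝ E - 1) + 0 * z))
      = ‖n‖ ^ 2 * (finrank ℝ E - 1) * (exp (-(w * (‖n‖ ^ 2 * z)))
        * (z ^ (s - 1) * max (1 - z) 0 ^ ((finrank ℝ E : ℝ) / 2 - s))) := fun z => by ring
  have e4 : w ^ (-(finrank ℝ E : ℝ) / 2 - 1) = w ^ (s - (finrank ℝ E : ℝ) / 2 - 1) * w ^ (-s) := by
    rw [← rpow_add hw]
    ring_nf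
  simp only [e2, e3]
  rw [integral_sub j2 j1, v1, integral_const_mul, e4]
  field_simp

end LaplaceTransforms

section BracketIntegrals

open Set Filter Topology Real Module

variable {E : Type*} [NormedAddCommGroup E] [InnerProductSpace ℝ E] [FiniteDimensional ℝ E]
  [MeasurableSpace E] [BorelSpace E] {n v : E} {s a : ℝ}

lemma ae_ne_of_finrank_pos (hd : 0 < finrank ℝ E) (n : E) : ∀ᵐ x : E, x ≠ n := by
  have : Nontrivial E := (finrank_pos_iff (R := ℝ)).1 hd
  exact compl_mem_ae_iff.2 (measure_singleton n)

lemma ae_gammaPrimitive_laplace (hd : 0 < finrank ℝ E) (ha : 1 ≤ a) :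
    ∀ᵐ x : E, IntegrableOn (fun w => gammaPrimitive a w * exp (-(w * ‖x‖ ^ 2))) (Ioi 0) ∧
      ∫ w in Ioi (0 : ℝ), gammaPrimitive a w * exp (-(w * ‖x‖ ^ 2))
        = (1 + ‖x‖ ^ 2) ^ (-a) / ‖x‖ ^ 2 := by
  filter_upwards [ae_ne_of_finrank_pos hd 0] with x hx
  have : 0 < ‖x‖ := norm_pos_iff.2 hx
  exact integral_gammaPrimitive_mul_exp ha (by positivity)

lemma integral_bracket_mul_sub_mul_transverse (hn : n ≠ 0) (hs : 0 < s)
    (hsd : 2 * s < finrank ℝ E) (ha : 1 ≤ a) (had : finrank ℝ E < 2 * a) :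
    Integrable (fun x : E => (1 + ‖x‖ ^ 2) ^ (-a) * (‖n - x‖ ^ (-(2 * s)) - ‖n‖ ^ (-(2 * s)))
      * (‖n‖ ^ 2 - ⟪n, x⟫ ^ 2 / ‖x‖ ^ 2)) ∧
    ∫ x : E, (1 + ‖x‖ ^ 2) ^ (-a) * (‖n - x‖ ^ (-(2 * s)) - ‖n‖ ^ (-(2 * s)))
        * (‖n‖ ^ 2 - ⟪n, x⟫ ^ 2 / ‖x‖ ^ 2)
      = π ^ ((finrank ℝ E : ℝ) / 2) / (2 * Gamma s) * (‖n‖ ^ 2 * (finrank ℝ E - 1))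
        * ∫ w in Ioi (0 : ℝ), gammaPrimitive a w * w ^ (s - (finrank ℝ E : ℝ) / 2 - 1)
          * ∫ z in Ioi (0 : ℝ), exp (-(w * (‖n‖ ^ 2 * z)))
            * (z ^ (s - 1) * (max (1 - z) 0 ^ ((finrank ℝ E : ℝ) / 2 - s) - 1)) := by
  have hn' : 0 < ‖n‖ := norm_pos_iff.2 hn
  have hd : 0 < finrank ℝ E := by
    have : (0 : ℝ) < finrank ℝ E := by linarith
    exact_mod_cast this
  have hae : ∀ᵐ x : E, (1 + ‖x‖ ^ 2) ^ (-a) / ‖x‖ ^ 2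
        * ((‖n - x‖ ^ (-(2 * s)) - ‖n‖ ^ (-(2 * s))) * (‖n‖ ^ 2 * ‖x‖ ^ 2 - ⟪n, x⟫ ^ 2))
      = (1 + ‖x‖ ^ 2) ^ (-a) * (‖n - x‖ ^ (-(2 * s)) - ‖n‖ ^ (-(2 * s)))
        * (‖n‖ ^ 2 - ⟪n, x⟫ ^ 2 / ‖x‖ ^ 2) := by
    filter_upwards [ae_ne_of_finrank_pos hd 0] with x hx
    have : ‖x‖ ≠ 0 := norm_ne_zero_iff.2 hx
    field_simp
  have hFint : Integrable fun x : E => (1 + ‖x‖ ^ 2) ^ (-a)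
      * (‖n - x‖ ^ (-(2 * s)) - ‖n‖ ^ (-(2 * s))) * (‖n‖ ^ 2 - ⟪n, x⟫ ^ 2 / ‖x‖ ^ 2) := by
    have i1 := integrable_bracket_rpow_mul_norm_rpow n (a := a) (by linarith) hs.le hsd
      (by linarith)
    have i2 := integrable_bracket_rpow_mul_norm_rpow n (a := a) (s := 0) (by linarith) le_rfl
      (by linarith) (by linarith)
    refine Integrable.mono' ((i1.add (i2.const_mul (‖n‖ ^ (-(2 * s))))).const_mul (‖n‖ ^ 2))
      (by apply Measurable.aestronglyMeasurable; fun_prop) ?_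
    filter_upwards [ae_ne_of_finrank_pos hd 0] with x hx
    have hx : 0 < ‖x‖ := norm_pos_iff.2 hx
    have hJ : 0 < (1 + ‖x‖ ^ 2) ^ (-a) := by positivity
    have h1 : |‖n‖ ^ 2 - ⟪n, x⟫ ^ 2 / ‖x‖ ^ 2| ≤ ‖n‖ ^ 2 := by
      have h := abs_transverse_le n x
      rw [show ‖n‖ ^ 2 - ⟪n, x⟫ ^ 2 / ‖x‖ ^ 2
          = (‖n‖ ^ 2 * ‖x‖ ^ 2 - ⟪n, x⟫ ^ 2) / ‖x‖ ^ 2 by field_simp, abs_div,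
        abs_of_pos (by positivity : 0 < ‖x‖ ^ 2), div_le_iff₀ (by positivity)]
      exact h
    have h2 : |‖n - x‖ ^ (-(2 * s)) - ‖n‖ ^ (-(2 * s))|
        ≤ ‖n - x‖ ^ (-(2 * s)) + ‖n‖ ^ (-(2 * s)) := by
      have e1 : 0 ≤ ‖n - x‖ ^ (-(2 * s)) := by positivity
      have e2 : 0 ≤ ‖n‖ ^ (-(2 * s)) := by positivity
      rw [abs_le]
      constructor <;> linarith
    rw [norm_mul, norm_mul, norm_of_nonneg hJ.le, norm_eq_abs, norm_eq_abs]
    simp only [Pi.add_apply, mul_zero, neg_zero, rpow_zero, mul_one]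
    calc _ ≤ (1 + ‖x‖ ^ 2) ^ (-a) * (‖n - x‖ ^ (-(2 * s)) + ‖n‖ ^ (-(2 * s))) * ‖n‖ ^ 2 := by
          gcongr
      _ = _ := by ring
  refine ⟨hFint, ?_⟩
  obtain ⟨-, h⟩ := integrable_integral_laplace (volume : Measure E) (m := gammaPrimitive a)
    (continuous_gammaPrimitive ha).measurable
    (fun w hw => gammaPrimitive_nonneg (by linarith) hw.le) (ρ := fun x => ‖x‖ ^ 2)
    (F := fun x => (‖n - x‖ ^ (-(2 * s)) - ‖n‖ ^ (-(2 * s)))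
      * (‖n‖ ^ 2 * ‖x‖ ^ 2 - ⟪n, x⟫ ^ 2)) (by fun_prop) (by fun_prop)
    (ae_gammaPrimitive_laplace hd ha) (hFint.congr (hae.mono fun x hx => hx.symm))
  rw [← integral_congr_ae hae, h, ← integral_const_mul]
  refine setIntegral_congr_fun measurableSet_Ioi fun w hw => ?_
  rw [integral_exp_neg_mul_sub_mul_transverse hn hw hs hsd]
  ring

lemma integral_bracket_mul_inner_sq (hv : ‖v‖ = 1) (hvn : ⟪v, n⟫ = 0) (hs : 0 < s)
    (hsd : 2 * s < finrank ℝ E) (has : finrank ℝ E < 2 * (a - 1 + s)) :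
    Integrable (fun x : E => (1 + ‖x‖ ^ 2) ^ (-a) * ‖n - x‖ ^ (-(2 * s)) * ⟪v, x⟫ ^ 2) ∧
    ∫ x : E, (1 + ‖x‖ ^ 2) ^ (-a) * ‖n - x‖ ^ (-(2 * s)) * ⟪v, x⟫ ^ 2
      = π ^ ((finrank ℝ E : ℝ) / 2) / (2 * Gamma s)
        * ∫ w in Ioi (0 : ℝ), gammaWeight a w * w ^ (s - (finrank ℝ E : ℝ) / 2 - 1)
          * ∫ z in Ioi (0 : ℝ), exp (-(w * (‖n‖ ^ 2 * z)))
            * (z ^ (s - 1) * max (1 - z) 0 ^ ((finrank ℝ E : ℝ) / 2 - s)) := by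
  have hae : ∀ x : E, (1 + ‖x‖ ^ 2) ^ (-a) * (‖n - x‖ ^ (-(2 * s)) * ⟪v, x⟫ ^ 2)
      = (1 + ‖x‖ ^ 2) ^ (-a) * ‖n - x‖ ^ (-(2 * s)) * ⟪v, x⟫ ^ 2 := fun x => by ring
  have hFint : Integrable fun x : E =>
      (1 + ‖x‖ ^ 2) ^ (-a) * ‖n - x‖ ^ (-(2 * s)) * ⟪v, x⟫ ^ 2 := by
    have i1 := integrable_bracket_rpow_mul_norm_rpow n (a := a - 1) (by linarith) hs.le hsd has
    refine Integrable.mono' i1 (by apply Measurable.aestronglyMeasurable; fun_prop)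
      (Eventually.of_forall fun x => ?_)
    have h := abs_inner_sq_le v x
    rw [hv, one_pow, one_mul, pow_one] at h
    rw [norm_mul, norm_of_nonneg (by positivity), norm_eq_abs]
    calc _ ≤ (1 + ‖x‖ ^ 2) ^ (-a) * ‖n - x‖ ^ (-(2 * s)) * (1 + ‖x‖ ^ 2) := by gcongr
      _ = _ := by
        rw [show -(a - 1) = -a + 1 by ring, rpow_add_one (by positivity)]
        ring
  refine ⟨hFint, ?_⟩
  obtain ⟨-, h⟩ := integrable_integral_laplace (volume : Measure E) (m := gammaWeight a)
    (measurable_gammaWeight a)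
    (fun w hw => gammaWeight_nonneg (by linarith) hw.le) (ρ := fun x => ‖x‖ ^ 2)
    (F := fun x => ‖n - x‖ ^ (-(2 * s)) * ⟪v, x⟫ ^ 2) (by fun_prop) (by fun_prop)
    (K := fun x => (1 + ‖x‖ ^ 2) ^ (-a)) (Eventually.of_forall fun x =>
      integral_gammaWeight_mul_exp (by linarith) (by positivity))
    (hFint.congr (Eventually.of_forall fun x => (hae x).symm))
  simp only [hae] at h
  rw [h, ← integral_const_mul]
  refine setIntegral_congr_fun measurableSet_Ioi fun w hw => ?_
  rw [integral_exp_neg_mul_norm_rpow_mul_inner_sq hv hvn hw hs hsd]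
  ring

lemma integral_bracket_mul_inner_mul_inner_sq (hv : ‖v‖ = 1) (hvn : ⟪v, n⟫ = 0) (hs : 0 < s)
    (hsd : 2 * s < finrank ℝ E) (ha : 1 ≤ a) (has : finrank ℝ E < 2 * (a - 1 + s)) :
    Integrable (fun x : E => (1 + ‖x‖ ^ 2) ^ (-a) * ‖n - x‖ ^ (-(2 * s))
      * (⟪n, x⟫ * ⟪v, x⟫ ^ 2 / ‖x‖ ^ 2)) ∧
    ∫ x : E, (1 + ‖x‖ ^ 2) ^ (-a) * ‖n - x‖ ^ (-(2 * s)) * (⟪n, x⟫ * ⟪v, x⟫ ^ 2 / ‖x‖ ^ 2)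
      = π ^ ((finrank ℝ E : ℝ) / 2) / (2 * Gamma s) * ‖n‖ ^ 2
        * ∫ w in Ioi (0 : ℝ), gammaPrimitive a w * w ^ (s - (finrank ℝ E : ℝ) / 2 - 1)
          * ∫ z in Ioi (0 : ℝ), exp (-(w * (‖n‖ ^ 2 * z)))
            * (z ^ s * max (1 - z) 0 ^ ((finrank ℝ E : ℝ) / 2 - s)) := by
  have hd : 0 < finrank ℝ E := by
    have : (0 : ℝ) < finrank ℝ E := by linarith
    exact_mod_cast this
  have hae : ∀ x : E, (1 + ‖x‖ ^ 2) ^ (-a) / ‖x‖ ^ 2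
        * (‖n - x‖ ^ (-(2 * s)) * (⟪n, x⟫ * ⟪v, x⟫ ^ 2))
      = (1 + ‖x‖ ^ 2) ^ (-a) * ‖n - x‖ ^ (-(2 * s)) * (⟪n, x⟫ * ⟪v, x⟫ ^ 2 / ‖x‖ ^ 2) :=
    fun x => by ring
  have hFint : Integrable fun x : E => (1 + ‖x‖ ^ 2) ^ (-a) * ‖n - x‖ ^ (-(2 * s))
      * (⟪n, x⟫ * ⟪v, x⟫ ^ 2 / ‖x‖ ^ 2) := by
    have i1 := integrable_bracket_rpow_mul_norm_rpow n (a := a - 1) (by linarith) hs.le hsd has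
    refine Integrable.mono' (i1.const_mul ‖n‖) (by apply Measurable.aestronglyMeasurable; fun_prop)
      ?_
    filter_upwards [ae_ne_of_finrank_pos hd 0] with x hx
    have hx : 0 < ‖x‖ := norm_pos_iff.2 hx
    have h : |⟪n, x⟫ * ⟪v, x⟫ ^ 2 / ‖x‖ ^ 2| ≤ ‖n‖ * (1 + ‖x‖ ^ 2) := by
      rw [abs_div, abs_of_pos (by positivity : 0 < ‖x‖ ^ 2), div_le_iff₀ (by positivity), abs_mul,
        abs_pow]
      have h1 := abs_real_inner_le_norm n x
      have h2 := abs_real_inner_le_norm v x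
      rw [hv, one_mul] at h2
      calc _ ≤ ‖n‖ * ‖x‖ * ‖x‖ ^ 2 := by gcongr
        _ ≤ _ := by
          gcongr
          nlinarith [sq_nonneg (‖x‖ - 1)]
    rw [norm_mul, norm_of_nonneg (by positivity), norm_eq_abs]
    calc _ ≤ (1 + ‖x‖ ^ 2) ^ (-a) * ‖n - x‖ ^ (-(2 * s)) * (‖n‖ * (1 + ‖x‖ ^ 2)) := by gcongr
      _ = _ := by
        rw [show -(a - 1) = -a + 1 by ring, rpow_add_one (by positivity)]
        ring
  refine ⟨hFint, ?_⟩
  obtain ⟨-, h⟩ := integrable_integral_laplace (volume : Measure E) (m := gammaPrimitive a)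
    (continuous_gammaPrimitive ha).measurable
    (fun w hw => gammaPrimitive_nonneg (by linarith) hw.le) (ρ := fun x => ‖x‖ ^ 2)
    (F := fun x => ‖n - x‖ ^ (-(2 * s)) * (⟪n, x⟫ * ⟪v, x⟫ ^ 2)) (by fun_prop) (by fun_prop)
    (ae_gammaPrimitive_laplace hd ha) (hFint.congr (Eventually.of_forall fun x => (hae x).symm))
  simp only [hae] at h
  rw [h, ← integral_const_mul]
  refine setIntegral_congr_fun measurableSet_Ioi fun w hw => ?_
  rw [integral_exp_neg_mul_norm_rpow_mul_inner_mul_inner_sq hv hvn hw hs hsd]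
  ring

end BracketIntegrals

section Asymptotics

open Set Filter Topology Real

variable {s α h : ℝ}

lemma abs_gammaPrimitive_mul_rpow_sub_le (ha : 1 ≤ h + α) {w : ℝ} (hw : 0 < w) :
    |gammaPrimitive (h + α) w * w ^ (s - h - 1)
        - 1 / Gamma (h + α + 1) * w ^ (s + 1 + α - 2)|
      ≤ 1 / Gamma (h + α + 1) * (w ^ (s + 1 + α - 2) * min 1 w) := by
  have e : w ^ (s + 1 + α - 2) = w ^ (h + α) * w ^ (s - h - 1) := by
    rw [← rpow_add hw]
    ring_nf
  rw [e, ← mul_assoc, ← sub_mul, abs_mul, abs_of_pos (rpow_pos_of_pos hw (s - h - 1))]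
  calc _ ≤ 1 / Gamma (h + α + 1) * (w ^ (h + α) * min 1 w) * w ^ (s - h - 1) := by
        gcongr
        exact abs_gammaPrimitive_sub_le ha hw.le
    _ = _ := by ring

lemma abs_gammaWeight_mul_rpow_sub_le (ha : 0 < h + α) {w : ℝ} (hw : 0 < w) :
    |gammaWeight (h + α) w * w ^ (s - h - 1) - 1 / Gamma (h + α) * w ^ (s + α - 2)|
      ≤ 1 / Gamma (h + α) * (w ^ (s + α - 2) * min 1 w) := by
  have e : w ^ (s + α - 2) = w ^ (h + α - 1) * w ^ (s - h - 1) := by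
    rw [← rpow_add hw]
    ring_nf
  rw [e, ← mul_assoc, ← sub_mul, abs_mul, abs_of_pos (rpow_pos_of_pos hw (s - h - 1))]
  calc _ ≤ 1 / Gamma (h + α) * (w ^ (h + α - 1) * min 1 w) * w ^ (s - h - 1) := by
        gcongr
        exact abs_gammaWeight_sub_le ha hw.le
    _ = _ := by ring

lemma max_one_sub_rpow_mem_Icc {z β : ℝ} (hz : 0 < z) (hβ : 0 ≤ β) :
    max (1 - z) 0 ^ β ∈ Icc (0 : ℝ) 1 :=
  ⟨rpow_nonneg (le_max_right _ _) _,
    rpow_le_one (le_max_right _ _) (max_le (by linarith) zero_le_one) hβ⟩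

lemma exists_asymptotics_transverse (hs : 0 < s) (hsh : s < h) (hα0 : 0 < α) (hα1 : α < 1)
    (ha : 1 ≤ h + α) :
    ∃ ρ : ℝ, 0 ≤ ρ ∧ ∀ L : ℝ, 0 < L →
      |(∫ w in Ioi (0 : ℝ), gammaPrimitive (h + α) w * w ^ (s - h - 1)
          * ∫ z in Ioi (0 : ℝ), exp (-(w * (L * z))) * (z ^ (s - 1) * (max (1 - z) 0 ^ (h - s) - 1)))
        - 1 / Gamma (h + α + 1) * Gamma (s + α) * L ^ (-(s + α))
          * (Gamma (-α) * Gamma (h - s + 1) / Gamma (h - s + 1 - α))| ≤ ρ * L ^ (-(s + 1)) := by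
  obtain ⟨hi, hv⟩ := integral_rpow_mul_posPart_rpow_sub_one hα0 hα1 (sub_pos.2 hsh)
  have e : ∀ z ∈ Ioi (0 : ℝ), z ^ (-α - 1) * (max (1 - z) 0 ^ (h - s) - 1)
      = z ^ (-(s + 1 + α - 1)) * (z ^ (s - 1) * (max (1 - z) 0 ^ (h - s) - 1)) := fun z hz => by
    rw [← mul_assoc, ← rpow_add hz]
    ring_nf
  rw [setIntegral_congr_fun measurableSet_Ioi e] at hv
  obtain ⟨ρ, hρ, hL⟩ := exists_laplace_asymptotics (q := s + 1) (by linarith) hα0 hα1 (by linarith)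
    (Φ := fun z => z ^ (s - 1) * (max (1 - z) 0 ^ (h - s) - 1)) (by fun_prop)
    (M := max 1 (h - s)) (fun z hz => by
      rw [abs_mul, abs_of_pos (rpow_pos_of_pos hz _), add_sub_cancel_right]
      calc _ ≤ z ^ (s - 1) * (max 1 (h - s) * z) := by
            gcongr
            exact abs_posPart_rpow_sub_one_le (sub_pos.2 hsh) hz
        _ = _ := by
          rw [rpow_sub_one hz.ne']
          field_simp)
    (hi.congr_fun e measurableSet_Ioi)
    (k := fun w => gammaPrimitive (h + α) w * w ^ (s - h - 1))
    ((continuous_gammaPrimitive ha).measurable.mul (by fun_prop))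
    (fun w hw => abs_gammaPrimitive_mul_rpow_sub_le ha hw)
  refine ⟨ρ, hρ, fun L hLp => ?_⟩
  have := hL L hLp
  rwa [hv, show s + 1 + α - 1 = s + α by ring] at this

lemma exists_asymptotics_mixed (hs : 0 < s) (hsh : s < h) (hα0 : 0 < α) (hα1 : α < 1)
    (ha : 1 ≤ h + α) :
    ∃ ρ : ℝ, 0 ≤ ρ ∧ ∀ L : ℝ, 0 < L →
      |(∫ w in Ioi (0 : ℝ), gammaPrimitive (h + α) w * w ^ (s - h - 1)
          * ∫ z in Ioi (0 : ℝ), exp (-(w * (L * z))) * (z ^ s * max (1 - z) 0 ^ (h - s)))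
        - 1 / Gamma (h + α + 1) * Gamma (s + α) * L ^ (-(s + α))
          * (Gamma (1 - α) * Gamma (h - s + 1) / Gamma (1 - α + (h - s) + 1))|
        ≤ ρ * L ^ (-(s + 1)) := by
  obtain ⟨hi, hv⟩ := integral_rpow_mul_posPart_rpow (sub_pos.2 hα1) (sub_pos.2 hsh)
  have e : ∀ z ∈ Ioi (0 : ℝ), z ^ (1 - α - 1) * max (1 - z) 0 ^ (h - s)
      = z ^ (-(s + 1 + α - 1)) * (z ^ s * max (1 - z) 0 ^ (h - s)) := fun z hz => by
    rw [← mul_assoc, ← rpow_add hz]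
    ring_nf
  rw [setIntegral_congr_fun measurableSet_Ioi e] at hv
  obtain ⟨ρ, hρ, hL⟩ := exists_laplace_asymptotics (q := s + 1) (by linarith) hα0 hα1 (by linarith)
    (Φ := fun z => z ^ s * max (1 - z) 0 ^ (h - s)) (by fun_prop)
    (M := 1) (fun z hz => by
      obtain ⟨h0, h1⟩ := max_one_sub_rpow_mem_Icc hz (sub_pos.2 hsh).le
      rw [abs_of_nonneg (by positivity), add_sub_cancel_right, one_mul]
      exact mul_le_of_le_one_right (by positivity) h1)
    (hi.congr_fun e measurableSet_Ioi)
    (k := fun w => gammaPrimitive (h + α) w * w ^ (s - h - 1))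
    ((continuous_gammaPrimitive ha).measurable.mul (by fun_prop))
    (fun w hw => abs_gammaPrimitive_mul_rpow_sub_le ha hw)
  refine ⟨ρ, hρ, fun L hLp => ?_⟩
  have := hL L hLp
  rwa [hv, show s + 1 + α - 1 = s + α by ring] at this

lemma exists_asymptotics_quadratic (hs : 0 < s) (hsh : s < h) (hα0 : 0 < α) (hα1 : α < 1)
    (hsα : 1 < s + α) :
    ∃ ρ : ℝ, 0 ≤ ρ ∧ ∀ L : ℝ, 0 < L →
      |(∫ w in Ioi (0 : ℝ), gammaWeight (h + α) w * w ^ (s - h - 1)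
          * ∫ z in Ioi (0 : ℝ), exp (-(w * (L * z))) * (z ^ (s - 1) * max (1 - z) 0 ^ (h - s)))
        - 1 / Gamma (h + α) * Gamma (s + α - 1) * L ^ (-(s + α - 1))
          * (Gamma (1 - α) * Gamma (h - s + 1) / Gamma (1 - α + (h - s) + 1))|
        ≤ ρ * L ^ (-s) := by
  obtain ⟨hi, hv⟩ := integral_rpow_mul_posPart_rpow (sub_pos.2 hα1) (sub_pos.2 hsh)
  have e : ∀ z ∈ Ioi (0 : ℝ), z ^ (1 - α - 1) * max (1 - z) 0 ^ (h - s)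
      = z ^ (-(s + α - 1)) * (z ^ (s - 1) * max (1 - z) 0 ^ (h - s)) := fun z hz => by
    rw [← mul_assoc, ← rpow_add hz]
    ring_nf
  rw [setIntegral_congr_fun measurableSet_Ioi e] at hv
  obtain ⟨ρ, hρ, hL⟩ := exists_laplace_asymptotics hs hα0 hα1 (by linarith)
    (Φ := fun z => z ^ (s - 1) * max (1 - z) 0 ^ (h - s)) (by fun_prop)
    (M := 1) (fun z hz => by
      obtain ⟨h0, h1⟩ := max_one_sub_rpow_mem_Icc hz (sub_pos.2 hsh).le
      rw [abs_of_nonneg (by positivity), one_mul]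
      exact mul_le_of_le_one_right (by positivity) h1)
    (hi.congr_fun e measurableSet_Ioi)
    (k := fun w => gammaWeight (h + α) w * w ^ (s - h - 1))
    ((measurable_gammaWeight _).mul (by fun_prop))
    (fun w hw => abs_gammaWeight_mul_rpow_sub_le (by linarith) hw)
  refine ⟨ρ, hρ, fun L hLp => ?_⟩
  have := hL L hLp
  rwa [hv] at this

end Asymptotics

section QuadraticForm

open Set Filter Topology Real Module

lemma leading_coefficient_eq_neg_etaC {d : ℕ} {s α : ℝ} (hs : 0 < s) (hsd : s < (d : ℝ) / 2)
    (hα0 : 0 < α) (hα1 : α < 1) (hsα : 1 < s + α) :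
    π ^ ((d : ℝ) / 2) / (2 * Gamma s) *
      (((d : ℝ) - 1) * (1 / Gamma ((d : ℝ) / 2 + α + 1) * Gamma (s + α)
          * (Gamma (-α) * Gamma ((d : ℝ) / 2 - s + 1) / Gamma ((d : ℝ) / 2 - s + 1 - α)))
        + ((d : ℝ) - 1) * (1 / Gamma ((d : ℝ) / 2 + α) * Gamma (s + α - 1)
          * (Gamma (1 - α) * Gamma ((d : ℝ) / 2 - s + 1) / Gamma (1 - α + ((d : ℝ) / 2 - s) + 1)))
        - 2 * (1 / Gamma ((d : ℝ) / 2 + α + 1) * Gamma (s + α)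
          * (Gamma (1 - α) * Gamma ((d : ℝ) / 2 - s + 1) / Gamma (1 - α + ((d : ℝ) / 2 - s) + 1))))
      = -etaC d s α := by
  have h1 : Gamma (s + α) = (s + α - 1) * Gamma (s + α - 1) := by
    rw [← Gamma_add_one (by linarith), sub_add_cancel]
  have h2 : Gamma (1 - α) = -α * Gamma (-α) := by
    rw [← Gamma_add_one (by linarith), neg_add_eq_sub]
  have h3 : Gamma ((d : ℝ) / 2 + α + 1) = ((d : ℝ) / 2 + α) * Gamma ((d : ℝ) / 2 + α) :=
    Gamma_add_one (by linarith)
  have h4 : Gamma (1 - α + ((d : ℝ) / 2 - s) + 1)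
      = ((d : ℝ) / 2 - s + 1 - α) * Gamma ((d : ℝ) / 2 - s + 1 - α) := by
    rw [← Gamma_add_one (by linarith)]
    ring_nf
  have p0 : Gamma s ≠ 0 := (Gamma_pos_of_pos hs).ne'
  have p1 : Gamma ((d : ℝ) / 2 + α) ≠ 0 := (Gamma_pos_of_pos (by linarith)).ne'
  have p2 : Gamma ((d : ℝ) / 2 - s + 1 - α) ≠ 0 := (Gamma_pos_of_pos (by linarith)).ne'
  have q1 : (d : ℝ) / 2 + α ≠ 0 := by linarith
  have q2 : (d : ℝ) / 2 - s + 1 - α ≠ 0 := by linarith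
  rw [etaC, Cconst, show ((d : ℝ) - 2 * s + 2) / 2 = (d : ℝ) / 2 - s + 1 by ring,
    show ((d : ℝ) + 2 + 2 * α) / 2 = (d : ℝ) / 2 + α + 1 by ring,
    show ((d : ℝ) + 4 - 2 * s - 2 * α) / 2 = 1 - α + ((d : ℝ) / 2 - s) + 1 by ring,
    h1, h2, h3, h4]
  generalize Gamma ((d : ℝ) / 2 - s + 1 - α) = G2 at *
  generalize Gamma ((d : ℝ) / 2 + α) = G1 at *
  generalize Gamma ((d : ℝ) / 2 - s + 1) = G3 at *
  have hd : (d : ℝ) = 2 * ((d : ℝ) / 2) := by ring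
  generalize π ^ ((d : ℝ) / 2) = P
  generalize (d : ℝ) / 2 = x at *
  rw [hd]
  field_simp
  ring

lemma jap_rpow {d : ℕ} (x : EuclideanSpace ℝ (Fin d)) (α : ℝ) :
    jap x ^ (-(d : ℝ) - 2 * α) = (1 + ‖x‖ ^ 2) ^ (-((d : ℝ) / 2 + α)) := by
  rw [jap, sqrt_eq_rpow, ← rpow_mul (by positivity)]
  ring_nf

lemma inner_Pperp_sub {d : ℕ} {v n : EuclideanSpace ℝ (Fin d)} (hvn : ⟪v, n⟫ = 0)
    (x : EuclideanSpace ℝ (Fin d)) :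
    ⟪v, Pperp x (n - x)⟫ = -(⟪n, x⟫ * ⟪v, x⟫ / ‖x‖ ^ 2) := by
  rw [Pperp, inner_sub_right, inner_sub_right, real_inner_smul_right, inner_sub_right, hvn,
    real_inner_self_eq_norm_sq, real_inner_comm n x]
  rcases eq_or_ne x 0 with rfl | hx
  · simp
  · have : ‖x‖ ≠ 0 := norm_ne_zero_iff.2 hx
    field_simp
    ring

lemma norm_Pperp_sub_sq {d : ℕ} (n x : EuclideanSpace ℝ (Fin d)) :
    ‖Pperp x (n - x)‖ ^ 2 = ‖n‖ ^ 2 - ⟪n, x⟫ ^ 2 / ‖x‖ ^ 2 := by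
  rw [Pperp, norm_sub_sq_real, norm_smul, real_inner_smul_right, mul_pow, norm_eq_abs, sq_abs,
    norm_sub_sq_real, inner_sub_left, inner_sub_right, real_inner_self_eq_norm_sq,
    real_inner_comm n x]
  rcases eq_or_ne x 0 with rfl | hx
  · simp
  · have : ‖x‖ ≠ 0 := norm_ne_zero_iff.2 hx
    field_simp
    ring

lemma norm_Pperp_le {d : ℕ} (k x : EuclideanSpace ℝ (Fin d)) : ‖Pperp k x‖ ≤ ‖x‖ := by
  refine le_of_sq_le_sq ?_ (norm_nonneg x)
  rw [Pperp, norm_sub_sq_real, norm_smul, real_inner_smul_right, mul_pow, norm_eq_abs, sq_abs,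
    real_inner_comm k x]
  rcases eq_or_ne k 0 with rfl | hk
  · simp
  · have : ‖k‖ ≠ 0 := norm_ne_zero_iff.2 hk
    have h : 0 ≤ ⟪k, x⟫ ^ 2 / ‖k‖ ^ 2 := by positivity
    have e : (⟪k, x⟫ / ‖k‖ ^ 2) ^ 2 * ‖k‖ ^ 2 = ⟪k, x⟫ ^ 2 / ‖k‖ ^ 2 := by field_simp
    have e2 : ⟪k, x⟫ / ‖k‖ ^ 2 * ⟪k, x⟫ = ⟪k, x⟫ ^ 2 / ‖k‖ ^ 2 := by ring
    rw [e, e2]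
    linarith

lemma sum_sum_mul_integral {X ι : Type*} [MeasurableSpace X] {μ : Measure X} [Fintype ι]
    {M : ι → ι → X → ℝ} (hM : ∀ i j, Integrable (M i j) μ) (v : ι → ℝ) :
    ∑ i, ∑ j, v i * (∫ x, M i j x ∂μ) * v j = ∫ x, ∑ i, ∑ j, v i * M i j x * v j ∂μ := by
  rw [integral_finsetSum _ fun i _ => integrable_finsetSum _ fun j _ =>
    ((hM i j).const_mul _).mul_const _]
  refine Finset.sum_congr rfl fun i _ => ?_
  rw [integral_finsetSum _ fun j _ => ((hM i j).const_mul _).mul_const _]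
  refine Finset.sum_congr rfl fun j _ => ?_
  rw [integral_mul_const, integral_const_mul]

lemma sum_sum_mul_inner {d : ℕ} (v x y : EuclideanSpace ℝ (Fin d)) (g : ℝ) :
    ∑ i, ∑ j, v i * (g * (x i * y j)) * v j = g * (⟪v, x⟫ * ⟪v, y⟫) := by
  have h : ∀ z : EuclideanSpace ℝ (Fin d), ⟪v, z⟫ = ∑ i, v i * z i := fun z => by
    simp [PiLp.inner_apply, mul_comm]
  rw [h, h, Finset.sum_mul_sum, Finset.mul_sum]
  refine Finset.sum_congr rfl fun i _ => ?_
  rw [Finset.mul_sum]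
  exact Finset.sum_congr rfl fun j _ => by ring

lemma sum_sum_mul_ite {d : ℕ} {v : EuclideanSpace ℝ (Fin d)} (hv : ‖v‖ = 1) (g : ℝ) :
    ∑ i, ∑ j, v i * (g * (if i = j then (1 : ℝ) else 0)) * v j = g := by
  have h : ∑ i, v i ^ 2 = 1 := by
    rw [← EuclideanSpace.real_norm_sq_eq, hv, one_pow]
  calc _ = ∑ i, g * v i ^ 2 := Finset.sum_congr rfl fun i _ => by
        simp
        ring
    _ = g := by rw [← Finset.mul_sum, h, mul_one]

lemma integrable_jap_mul_norm_rpow_mul_norm_sq {d : ℕ} {s α : ℝ} (hs : 0 < s)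
    (hsd : s < (d : ℝ) / 2) (hsα : 1 < s + α) (n : EuclideanSpace ℝ (Fin d)) :
    Integrable fun k : EuclideanSpace ℝ (Fin d) =>
      jap (n - k) ^ (-(d : ℝ) - 2 * α) * ‖k‖ ^ (-(2 * s)) * ‖k‖ ^ 2 := by
  have hD : (finrank ℝ (EuclideanSpace ℝ (Fin d)) : ℝ) = d := by simp
  have i1 : Integrable fun k : EuclideanSpace ℝ (Fin d) =>
      (1 + ‖n - k‖ ^ 2) ^ (-((d : ℝ) / 2 + α - 1)) * ‖k‖ ^ (-(2 * s)) := by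
    have := (integrable_bracket_rpow_mul_norm_rpow n (a := (d : ℝ) / 2 + α - 1) (s := s)
      (by linarith) hs.le (by rw [hD]; linarith) (by rw [hD]; linarith)).comp_sub_left n
    simpa using this
  simp only [jap_rpow]
  refine Integrable.mono' (i1.const_mul (2 * (1 + ‖n‖ ^ 2)))
    (by apply Measurable.aestronglyMeasurable; fun_prop) (Eventually.of_forall fun k => ?_)
  rw [norm_of_nonneg (by positivity)]
  have h := one_add_norm_sq_le n k
  calc _ ≤ (1 + ‖n - k‖ ^ 2) ^ (-((d : ℝ) / 2 + α)) * ‖k‖ ^ (-(2 * s))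
        * (2 * (1 + ‖n‖ ^ 2) * (1 + ‖n - k‖ ^ 2)) := by
        gcongr
        linarith
    _ = _ := by
      rw [show -((d : ℝ) / 2 + α - 1) = -((d : ℝ) / 2 + α) + 1 by ring,
        rpow_add_one (by positivity)]
      ring

lemma measurable_jap {d : ℕ} : Measurable (jap : EuclideanSpace ℝ (Fin d) → ℝ) := by
  unfold jap
  fun_prop

lemma integrable_jap_mul_norm_rpow_mul {d : ℕ} {s α : ℝ} (hs : 0 < s)
    (hsd : s < (d : ℝ) / 2) (hsα : 1 < s + α) (n : EuclideanSpace ℝ (Fin d))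
    {Q : EuclideanSpace ℝ (Fin d) → ℝ} (hQ : Measurable Q) (hQk : ∀ k, |Q k| ≤ ‖k‖ ^ 2) :
    Integrable fun k : EuclideanSpace ℝ (Fin d) =>
      jap (n - k) ^ (-(d : ℝ) - 2 * α) * ‖k‖ ^ (-(2 * s)) * Q k := by
  refine (integrable_jap_mul_norm_rpow_mul_norm_sq hs hsd hsα n).mono'
    (Measurable.aestronglyMeasurable ?_) (Eventually.of_forall fun k => ?_)
  · exact (((measurable_jap.comp (by fun_prop)).pow_const _).mul (by fun_prop)).mul hQ
  · have h : 0 ≤ jap (n - k) ^ (-(d : ℝ) - 2 * α) * ‖k‖ ^ (-(2 * s)) := by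
      rw [jap_rpow]
      positivity
    rw [norm_mul, norm_of_nonneg h, norm_eq_abs]
    exact mul_le_mul_of_nonneg_left (hQk k) h

lemma sum_sum_mul_Hmat {d : ℕ} {s α : ℝ} (hd : 2 ≤ d) (hs : 0 < s) (hsd : s < (d : ℝ) / 2)
    (hα0 : 0 < α) (hsα : 1 < s + α) {n v : EuclideanSpace ℝ (Fin d)} (hn : n ≠ 0)
    (hv : ‖v‖ = 1) (hvn : ⟪v, n⟫ = 0) :
    ∑ i, ∑ j, v i * Hmat d s α n i j * v j
      = (∫ x : EuclideanSpace ℝ (Fin d), (1 + ‖x‖ ^ 2) ^ (-((d : ℝ) / 2 + α))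
          * (‖n - x‖ ^ (-(2 * s)) - ‖n‖ ^ (-(2 * s))) * (‖n‖ ^ 2 - ⟪n, x⟫ ^ 2 / ‖x‖ ^ 2))
        + ((d : ℝ) - 1) * (∫ x : EuclideanSpace ℝ (Fin d), (1 + ‖x‖ ^ 2) ^ (-((d : ℝ) / 2 + α))
          * ‖n - x‖ ^ (-(2 * s)) * ⟪v, x⟫ ^ 2)
        - 2 * ∫ x : EuclideanSpace ℝ (Fin d), (1 + ‖x‖ ^ 2) ^ (-((d : ℝ) / 2 + α))
          * ‖n - x‖ ^ (-(2 * s)) * (⟪n, x⟫ * ⟪v, x⟫ ^ 2 / ‖x‖ ^ 2) := by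
  have hD : (finrank ℝ (EuclideanSpace ℝ (Fin d)) : ℝ) = d := by simp
  have hd' : (2 : ℝ) ≤ d := by exact_mod_cast hd
  have hA : Integrable fun k : EuclideanSpace ℝ (Fin d) => jap (n - k) ^ (-(d : ℝ) - 2 * α)
      * (‖k‖ ^ (-(2 * s)) - ‖n‖ ^ (-(2 * s))) * ‖Pperp (n - k) k‖ ^ 2 := by
    have := ((integral_bracket_mul_sub_mul_transverse (a := (d : ℝ) / 2 + α) hn hs
      (by rw [hD]; linarith) (by linarith) (by rw [hD]; linarith)).1).comp_sub_left n
    refine this.congr (Eventually.of_forall fun k => ?_)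
    have h := norm_Pperp_sub_sq n (n - k)
    rw [sub_sub_cancel] at h
    simp only [sub_sub_cancel]
    rw [jap_rpow, h]
  have hcoord : ∀ (x : EuclideanSpace ℝ (Fin d)) i, |x i| ≤ ‖x‖ := fun x i => by
    simpa using PiLp.norm_apply_le x i
  have hB : ∀ i j, Integrable fun k : EuclideanSpace ℝ (Fin d) =>
      jap (n - k) ^ (-(d : ℝ) - 2 * α) * ‖k‖ ^ (-(2 * s)) * (k i * k j) := fun i j =>
    integrable_jap_mul_norm_rpow_mul hs hsd hsα n (by fun_prop) fun k => by
      rw [abs_mul, sq]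
      exact mul_le_mul (hcoord k i) (hcoord k j) (abs_nonneg _) (norm_nonneg _)
  have hPm : ∀ i, Measurable fun k : EuclideanSpace ℝ (Fin d) => Pperp (n - k) k i := fun i => by
    simp only [Pperp, PiLp.sub_apply, PiLp.smul_apply, smul_eq_mul]
    fun_prop
  have hC : ∀ i j, Integrable fun k : EuclideanSpace ℝ (Fin d) =>
      jap (n - k) ^ (-(d : ℝ) - 2 * α) * ‖k‖ ^ (-(2 * s)) * (Pperp (n - k) k i * k j) := fun i j =>
    integrable_jap_mul_norm_rpow_mul hs hsd hsα n ((hPm i).mul (by fun_prop)) fun k => by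
      rw [abs_mul, sq]
      exact mul_le_mul ((hcoord _ i).trans (norm_Pperp_le _ k)) (hcoord k j) (abs_nonneg _)
        (norm_nonneg _)
  have hsplit : ∀ i j, v i * Hmat d s α n i j * v j
      = v i * (∫ k : EuclideanSpace ℝ (Fin d), jap (n - k) ^ (-(d : ℝ) - 2 * α)
          * (‖k‖ ^ (-(2 * s)) - ‖n‖ ^ (-(2 * s))) * ‖Pperp (n - k) k‖ ^ 2
          * (if i = j then (1 : ℝ) else 0)) * v j
        + ((d : ℝ) - 1) * (v i * (∫ k : EuclideanSpace ℝ (Fin d),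
          jap (n - k) ^ (-(d : ℝ) - 2 * α) * ‖k‖ ^ (-(2 * s)) * (k i * k j)) * v j)
        - 2 * (v i * (∫ k : EuclideanSpace ℝ (Fin d),
          jap (n - k) ^ (-(d : ℝ) - 2 * α) * ‖k‖ ^ (-(2 * s)) * (Pperp (n - k) k i * k j)) * v j) := by
    intro i j
    simp only [Hmat, Matrix.sub_apply, Matrix.add_apply, Matrix.smul_apply, Matrix.of_apply,
      smul_eq_mul]
    ring
  simp only [hsplit, Finset.sum_sub_distrib, Finset.sum_add_distrib, ← Finset.mul_sum]
  rw [sum_sum_mul_integral (fun i j => hA.mul_const _), sum_sum_mul_integral hB,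
    sum_sum_mul_integral hC]
  simp only [sum_sum_mul_ite hv, sum_sum_mul_inner]
  rw [← integral_sub_left_eq_self _ _ n,
    ← integral_sub_left_eq_self (fun k => _ * (⟪v, k⟫ * ⟪v, k⟫)) _ n,
    ← integral_sub_left_eq_self (fun k => _ * (⟪v, Pperp (n - k) k⟫ * ⟪v, k⟫)) _ n]
  simp only [sub_sub_cancel, jap_rpow, norm_Pperp_sub_sq, inner_Pperp_sub hvn, inner_sub_right,
    hvn, zero_sub]
  have e1 : ∀ g t : ℝ, g * (-t * -t) = g * t ^ 2 := fun g t => by ring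
  have e2 : ∀ g b t r : ℝ, g * (-(b * t / r) * -t) = g * (b * t ^ 2 / r) := fun g b t r => by ring
  simp only [e1, e2]

end QuadraticForm

/-- Main bound on the matrix-valued integral `ℍ_{d,s,α}`: for `d ≥ 2`,
`s ∈ (0,d/2)`, `α ∈ (0,1)` with `s+α > 1`, there is `ρ ≥ 0` such that for every `n ≠ 0`
and every unit vector `v ⊥ n`,
`|v·ℍ_{d,s,α}(n)v + η_{d,s,α} |n|^{−2s+2−2α}| ≤ ρ |n|^{−2s}`. -/
theorem stmt0 (d : ℕ) (hd : 2 ≤ d) (s α : ℝ) (hs0 : 0 < s) (hsd : s < (d : ℝ)/2)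
    (hα0 : 0 < α) (hα1 : α < 1) (hsα : 1 < s + α) :
    ∃ ρ : ℝ, 0 ≤ ρ ∧ ∀ n : EuclideanSpace ℝ (Fin d), n ≠ 0 →
      ∀ v : EuclideanSpace ℝ (Fin d), ‖v‖ = 1 → ⟪v, n⟫ = 0 →
        |(∑ i, ∑ j, v i * Hmat d s α n i j * v j)
            + etaC d s α * ‖n‖ ^ (-(2*s) + 2 - 2*α)|
          ≤ ρ * ‖n‖ ^ (-(2*s)) := by
  have hd' : (2 : ℝ) ≤ d := by exact_mod_cast hd
  have hD : (Module.finrank ℝ (EuclideanSpace ℝ (Fin d)) : ℝ) = d := by simp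
  obtain ⟨ρA, hρA, hA⟩ := exists_asymptotics_transverse hs0 hsd hα0 hα1 (by linarith)
  obtain ⟨ρB, hρB, hB⟩ := exists_asymptotics_quadratic hs0 hsd hα0 hα1 hsα
  obtain ⟨ρC, hρC, hC⟩ := exists_asymptotics_mixed hs0 hsd hα0 hα1 (by linarith)
  have hη := leading_coefficient_eq_neg_etaC hs0 hsd hα0 hα1 hsα
  have hc : 0 < Real.pi ^ ((d : ℝ) / 2) / (2 * Real.Gamma s) := by
    have := Real.Gamma_pos_of_pos hs0
    positivity
  set c : ℝ := Real.pi ^ ((d : ℝ) / 2) / (2 * Real.Gamma s) with hcdef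
  have hd1 : (0 : ℝ) ≤ d - 1 := by linarith
  refine ⟨c * (d - 1) * ρA + c * (d - 1) * ρB + c * 2 * ρC, by positivity,
    fun n hn v hv hvn => ?_⟩
  have hn' : 0 < ‖n‖ := norm_pos_iff.2 hn
  have hL : 0 < ‖n‖ ^ 2 := by positivity
  have hpow : ∀ r : ℝ, (‖n‖ ^ 2) ^ r = ‖n‖ ^ (2 * r) := fun r => by
    rw [← Real.rpow_natCast, ← Real.rpow_mul hn'.le]
    norm_num
  have hmul : ∀ r : ℝ, ‖n‖ ^ 2 * (‖n‖ ^ 2) ^ (r - 1) = ‖n‖ ^ (2 * r) := fun r => by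
    rw [← hpow, Real.rpow_sub_one hL.ne']
    field_simp
  have hA := hA _ hL
  have hB := hB _ hL
  have hC := hC _ hL
  rw [sum_sum_mul_Hmat hd hs0 hsd hα0 hsα hn hv hvn,
    (integral_bracket_mul_sub_mul_transverse (a := (d : ℝ) / 2 + α) hn hs0
      (by rw [hD]; linarith) (by linarith) (by rw [hD]; linarith)).2,
    (integral_bracket_mul_inner_sq (a := (d : ℝ) / 2 + α) hv hvn hs0
      (by rw [hD]; linarith) (by rw [hD]; linarith)).2,
    (integral_bracket_mul_inner_mul_inner_sq (a := (d : ℝ) / 2 + α) hv hvn hs0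
      (by rw [hD]; linarith) (by linarith) (by rw [hD]; linarith)).2, hD, ← hcdef]
  generalize (∫ w in Set.Ioi (0 : ℝ), gammaPrimitive ((d : ℝ) / 2 + α) w * w ^ (s - (d : ℝ) / 2 - 1)
    * ∫ z in Set.Ioi (0 : ℝ), Real.exp (-(w * (‖n‖ ^ 2 * z)))
      * (z ^ (s - 1) * (max (1 - z) 0 ^ ((d : ℝ) / 2 - s) - 1))) = XA at *
  generalize (∫ w in Set.Ioi (0 : ℝ), gammaWeight ((d : ℝ) / 2 + α) w * w ^ (s - (d : ℝ) / 2 - 1)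
    * ∫ z in Set.Ioi (0 : ℝ), Real.exp (-(w * (‖n‖ ^ 2 * z)))
      * (z ^ (s - 1) * max (1 - z) 0 ^ ((d : ℝ) / 2 - s))) = XB at *
  generalize (∫ w in Set.Ioi (0 : ℝ), gammaPrimitive ((d : ℝ) / 2 + α) w * w ^ (s - (d : ℝ) / 2 - 1)
    * ∫ z in Set.Ioi (0 : ℝ), Real.exp (-(w * (‖n‖ ^ 2 * z)))
      * (z ^ s * max (1 - z) 0 ^ ((d : ℝ) / 2 - s))) = XC at *
  set R := ‖n‖ ^ (-(2 * s)) with hR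
  set S := ‖n‖ ^ (-(2 * s) + 2 - 2 * α) with hS
  have hN1 : ‖n‖ ^ 2 * (‖n‖ ^ 2) ^ (-(s + 1)) = R := by
    rw [show -(s + 1) = -s - 1 by ring, hmul, hR]
    ring_nf
  have hN2 : ‖n‖ ^ 2 * (‖n‖ ^ 2) ^ (-(s + α)) = S := by
    rw [show -(s + α) = (1 - s - α) - 1 by ring, hmul, hS]
    ring_nf
  have hN3 : (‖n‖ ^ 2) ^ (-s) = R := by
    rw [hpow, hR]
    ring_nf
  have hN4 : (‖n‖ ^ 2) ^ (-(s + α - 1)) = S := by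
    rw [hpow, hS]
    ring_nf
  rw [hN3, hN4] at hB
  have hscale : ∀ b x y : ℝ, 0 ≤ b → |x| ≤ y → |b * x| ≤ b * y := fun b x y hb hxy => by
    rw [abs_mul, abs_of_nonneg hb]
    gcongr
  have hA' := hscale (c * (d - 1) * ‖n‖ ^ 2) _ _ (by positivity) hA
  have hB' := hscale (c * (d - 1)) _ _ (by positivity) hB
  have hC' := hscale (c * 2 * ‖n‖ ^ 2) _ _ (by positivity) hC
  have key := (abs_sub _ _).trans (add_le_add ((abs_add_le _ _).trans (add_le_add hA' hB')) hC')
  rw [← neg_eq_iff_eq_neg.2 hη]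
  refine (le_of_eq ?_).trans (key.trans (le_of_eq ?_))
  · congr 1
    rw [← hN2]
    ring
  · rw [← hN1]
    ring
end
end

section
/- Let a ∈ ℝ, b > 0, s > 0 with b + 2 − 2s > 0, and define f_{a,b,s}(t) := t^a ∫₀^π (sin θ)^b (1 − 2t cos θ + t²)^{−s} dθ for t > 0. Then for every z ∈ ℂ with −a < Re(z) < 2s − a, the integral ∫₀^∞ t^{z−1} f_{a,b,s}(t) dt converges absolutely and equals (√π · Γ((b−2s+2)/2) · Γ((b+1)/2) / (2 Γ(s))) · Γ((2s−z−a)/2) · Γ((z+a)/2) / ( Γ((b−a−z+2)/2) · Γ((b+a−2s+2+z)/2) ). -/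
open MeasureTheory Real

noncomputable section

/-- The function `f_{a,b,s}(t) = t^a ∫₀^π (sin θ)^b (1 − 2t cos θ + t²)^{−s} dθ`. -/
def fabs (a b s : ℝ) (t : ℝ) : ℝ :=
  t ^ a * ∫ θ in (0:ℝ)..π, (Real.sin θ) ^ b * (1 - 2*t*Real.cos θ + t^2) ^ (-s)

open Set Filter Topology
open scoped Nat

/-- The binomial series of `(1 - x) ^ (-a)`, with coefficients written as Gamma values. -/
lemma Complex.hasSum_Gamma_add_nat_mul_pow {a x : ℂ} (ha : 0 < a.re) (hx : ‖x‖ < 1) :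
    HasSum (fun n : ℕ => Complex.Gamma (a + n) / n ! * x ^ n)
      (Complex.Gamma a * (1 - x) ^ (-a)) := by
  have hpole (k : ℕ) : a ≠ -k := by
    rintro rfl
    have : (0 : ℝ) ≤ k := k.cast_nonneg
    simp at ha
    linarith
  have h := (Complex.one_div_one_sub_cpow_hasFPowerSeriesOnBall_zero a).hasSum (y := x)
    (by
      rw [Metric.mem_eball, edist_zero_right, ← ofReal_norm]
      exact ENNReal.ofReal_lt_one.2 hx)
  rw [Complex.cpow_neg, ← one_div]
  convert! h.mul_left (Complex.Gamma a) using 1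
  · ext n
    have hc : Ring.choose (a + n - 1) n = Complex.Gamma (a + n) / Complex.Gamma a / n ! := by
      rw [Complex.Gamma_add_nat_div_Gamma_eq a hpole, eq_div_iff (by exact_mod_cast n.factorial_ne_zero), Ring.choose,
        show a + n - 1 - n + 1 = a by ring, mul_comm, ← nsmul_eq_mul,
        Ring.factorial_nsmul_multichoose_eq_ascPochhammer, Polynomial.ascPochhammer_smeval_eq_eval]
    have := Complex.Gamma_ne_zero_of_re_pos ha
    simp [hc]
    field_simp
  · simp

lemma Real.hasSum_Gamma_add_nat_mul_pow {a x : ℝ} (ha : 0 < a) (hx : |x| < 1) :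
    HasSum (fun n : ℕ => Real.Gamma (a + n) / n ! * x ^ n)
      (Real.Gamma a * (1 - x) ^ (-a)) := by
  have h := Complex.hasSum_Gamma_add_nat_mul_pow (a := a) (x := x) (by simpa) (by simpa)
  rw [← Complex.hasSum_ofReal]
  have hx1 : 0 ≤ 1 - x := by linarith [le_abs_self x]
  push_cast [Complex.ofReal_cpow hx1]
  convert! h using 1
  · ext n
    rw [← Complex.Gamma_ofReal]
    simp
  · rw [← Complex.Gamma_ofReal]

lemma Complex.norm_Gamma_le {a : ℂ} (ha : 0 < a.re) :
    ‖Complex.Gamma a‖ ≤ Real.Gamma a.re := by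
  rw [Complex.Gamma_eq_integral ha, Real.Gamma_eq_integral ha, Complex.GammaIntegral]
  refine (norm_integral_le_integral_norm _).trans_eq
    (setIntegral_congr_fun measurableSet_Ioi fun x hx => ?_)
  simp [Complex.norm_cpow_eq_rpow_re_of_pos hx, Complex.norm_exp]

lemma Complex.integrableOn_beta {u v : ℂ} (hu : 0 < u.re) (hv : 0 < v.re) :
    IntegrableOn (fun x : ℝ => (x : ℂ) ^ (u - 1) * (1 - (x : ℂ)) ^ (v - 1)) (Ioo 0 1) :=
  ((intervalIntegrable_iff_integrableOn_Ioc_of_le zero_le_one).1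
    (Complex.betaIntegral_convergent hu hv)).mono_set Ioo_subset_Ioc_self

lemma Complex.integral_beta {u v : ℂ} (hu : 0 < u.re) (hv : 0 < v.re) :
    ∫ x in Ioo (0 : ℝ) 1, (x : ℂ) ^ (u - 1) * (1 - (x : ℂ)) ^ (v - 1)
      = Complex.Gamma u * Complex.Gamma v / Complex.Gamma (u + v) := by
  rw [← Complex.betaIntegral_eq_Gamma_mul_div u v hu hv, Complex.betaIntegral,
    intervalIntegral.integral_of_le zero_le_one, integral_Ioc_eq_integral_Ioo]

lemma Real.ofReal_beta {u v x : ℝ} (hx : x ∈ Ioo (0 : ℝ) 1) :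
    ((x ^ (u - 1) * (1 - x) ^ (v - 1) : ℝ) : ℂ)
      = (x : ℂ) ^ ((u : ℂ) - 1) * (1 - (x : ℂ)) ^ ((v : ℂ) - 1) := by
  push_cast [Complex.ofReal_cpow hx.1.le, Complex.ofReal_cpow (sub_nonneg.2 hx.2.le)]
  rfl

lemma Real.integrableOn_beta {u v : ℝ} (hu : 0 < u) (hv : 0 < v) :
    IntegrableOn (fun x : ℝ => x ^ (u - 1) * (1 - x) ^ (v - 1)) (Ioo 0 1) := by
  refine ((Complex.integrableOn_beta (u := u) (v := v) (by simpa) (by simpa)).re).congr ?_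
  filter_upwards [ae_restrict_mem measurableSet_Ioo] with x hx
  rw [← Real.ofReal_beta hx]
  simp

lemma Real.integral_beta {u v : ℝ} (hu : 0 < u) (hv : 0 < v) :
    ∫ x in Ioo (0 : ℝ) 1, x ^ (u - 1) * (1 - x) ^ (v - 1)
      = Real.Gamma u * Real.Gamma v / Real.Gamma (u + v) := by
  have h := Complex.integral_beta (u := u) (v := v) (by simpa) (by simpa)
  rw [← setIntegral_congr_fun measurableSet_Ioo fun x hx => Real.ofReal_beta hx,
    integral_complex_ofReal] at h
  rw [← Complex.ofReal_inj, h]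
  push_cast [← Complex.Gamma_ofReal]
  rfl

/-- **Gauss's summation theorem** for `₂F₁(a, b; c; 1)`, in Gamma-function form. -/
lemma Complex.hasSum_Gamma_gauss {a b c : ℂ} (ha : 0 < a.re) (hb : 0 < b.re)
    (hc : 0 < (c - a - b).re) :
    HasSum (fun k : ℕ => Complex.Gamma (a + k) * Complex.Gamma (b + k)
        / (k ! * Complex.Gamma (c + k)))
      (Complex.Gamma a * Complex.Gamma b * Complex.Gamma (c - a - b)
        / (Complex.Gamma (c - a) * Complex.Gamma (c - b))) := by
  have hcb : 0 < (c - b).re := by simp at hc ⊢; linarith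
  have hG := Complex.Gamma_ne_zero_of_re_pos hcb
  have hterm (k : ℕ) {x : ℝ} (hx : x ∈ Ioo (0 : ℝ) 1) :
      (x : ℂ) ^ (b + k - 1) * (1 - (x : ℂ)) ^ (c - b - 1)
        = (x : ℂ) ^ (b - 1) * (1 - (x : ℂ)) ^ (c - b - 1) * (x : ℂ) ^ k := by
    have hx0 : (x : ℂ) ≠ 0 := by exact_mod_cast hx.1.ne'
    rw [show b + k - 1 = b - 1 + k by ring, Complex.cpow_add _ _ hx0, Complex.cpow_natCast]
    ring
  have hre (k : ℕ) : 0 < (b + k).re := by simp; positivity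
  have hint (k : ℕ) := Complex.integrableOn_beta (hre k) hcb
  have key : HasSum (fun k : ℕ => ∫ x in Ioo (0 : ℝ) 1, Complex.Gamma (a + k) / k ! *
        ((x : ℂ) ^ (b + k - 1) * (1 - (x : ℂ)) ^ (c - b - 1)))
      (∫ x in Ioo (0 : ℝ) 1, Complex.Gamma a *
        ((x : ℂ) ^ (b - 1) * (1 - (x : ℂ)) ^ (c - a - b - 1))) := by
    have hnorm (x : ℝ) (hx : x ∈ Ioo (0 : ℝ) 1) :
        HasSum (fun k : ℕ => x ^ (b.re - 1) * (1 - x) ^ ((c - b).re - 1) *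
            (Real.Gamma (a.re + k) / k ! * x ^ k))
          (Real.Gamma a.re * (x ^ (b.re - 1) * (1 - x) ^ ((c - a - b).re - 1))) := by
      convert! (Real.hasSum_Gamma_add_nat_mul_pow ha
        (by rw [abs_of_pos hx.1]; exact hx.2)).mul_left _ using 1
      have : (1 - x) ^ ((c - a - b).re - 1) = (1 - x) ^ ((c - b).re - 1) * (1 - x) ^ (-a.re) := by
        rw [← Real.rpow_add (by linarith [hx.2])]
        congr 1
        simp
        ring
      rw [this]
      ring
    refine hasSum_integral_of_dominated_convergence
      (fun k x => x ^ (b.re - 1) * (1 - x) ^ ((c - b).re - 1) *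
        (Real.Gamma (a.re + k) / k ! * x ^ k))
      (fun k => ((hint k).const_mul _).aestronglyMeasurable) (fun k => ?_) ?_ ?_ ?_
    · filter_upwards [ae_restrict_mem measurableSet_Ioo] with x hx
      have h1x : 0 < 1 - x := by linarith [hx.2]
      have hΓ := Complex.norm_Gamma_le (a := a + k) (by simp; positivity)
      rw [hterm k hx, show 1 - (x : ℂ) = ((1 - x : ℝ) : ℂ) by push_cast; rfl, norm_mul, norm_mul, norm_mul,
        Complex.norm_cpow_eq_rpow_re_of_pos hx.1, Complex.norm_cpow_eq_rpow_re_of_pos h1x,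
        norm_div, norm_pow, Complex.norm_real, Real.norm_of_nonneg hx.1.le, Complex.norm_natCast]
      simp only [Complex.add_re, Complex.natCast_re, Complex.sub_re, Complex.one_re] at hΓ ⊢
      have := Real.rpow_nonneg hx.1.le (b.re - 1)
      have := Real.rpow_nonneg h1x.le (c.re - b.re - 1)
      have := hx.1
      calc _ = x ^ (b.re - 1) * (1 - x) ^ (c.re - b.re - 1) *
            (‖Complex.Gamma (a + k)‖ / k ! * x ^ k) := by ring
        _ ≤ _ := by gcongr
    · filter_upwards [ae_restrict_mem measurableSet_Ioo] with x hx using (hnorm x hx).summable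
    · refine ((Real.integrableOn_beta hb hc).const_mul (Real.Gamma a.re)).congr ?_
      filter_upwards [ae_restrict_mem measurableSet_Ioo] with x hx using (hnorm x hx).tsum_eq.symm
    · filter_upwards [ae_restrict_mem measurableSet_Ioo] with x hx
      have h1x : (1 - (x : ℂ)) ≠ 0 := by
        have : (1 - x) ≠ 0 := by linarith [hx.2]
        exact_mod_cast this
      have hs := (Complex.hasSum_Gamma_add_nat_mul_pow (x := x) ha
        (by rw [Complex.norm_real, Real.norm_of_nonneg hx.1.le]; exact hx.2)).mul_left
        ((x : ℂ) ^ (b - 1) * (1 - (x : ℂ)) ^ (c - b - 1))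
      convert! hs using 1
      · ext k
        rw [hterm k hx]
        ring
      · rw [show c - a - b - 1 = c - b - 1 + -a by ring, Complex.cpow_add _ _ h1x]
        ring
  convert! key.div_const (Complex.Gamma (c - b)) using 1
  · ext k
    rw [integral_const_mul, Complex.integral_beta (hre k) hcb,
      show b + k + (c - b) = c + k by ring]
    field_simp
  · rw [integral_const_mul, Complex.integral_beta hb hc, show b + (c - a - b) = c - a by ring]
    field_simp

lemma image_sq_div_one_add_sq : (fun t : ℝ => t ^ 2 / (1 + t ^ 2)) '' Ioi 0 = Ioo 0 1 := by
  ext x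
  constructor
  · rintro ⟨t, ht : 0 < t, rfl⟩
    exact ⟨by positivity, (div_lt_one (by positivity)).2 (by linarith)⟩
  · rintro ⟨h0, h1⟩
    have h1' : 0 < 1 - x := by linarith
    refine ⟨√(x / (1 - x)), Real.sqrt_pos.2 (by positivity), ?_⟩
    simp only
    rw [Real.sq_sqrt (by positivity)]
    field_simp
    ring

lemma injOn_sq_div_one_add_sq : InjOn (fun t : ℝ => t ^ 2 / (1 + t ^ 2)) (Ioi 0) := by
  intro x (hx : 0 < x) y (hy : 0 < y) h
  have h' : x ^ 2 = y ^ 2 := by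
    have : x ^ 2 * (1 + y ^ 2) = y ^ 2 * (1 + x ^ 2) :=
      (div_eq_div_iff (by positivity) (by positivity)).1 h
    linarith
  exact (pow_left_inj₀ hx.le hy.le two_ne_zero).1 h'

lemma hasDerivWithinAt_sq_div_one_add_sq (t : ℝ) (s : Set ℝ) :
    HasDerivWithinAt (fun t : ℝ => t ^ 2 / (1 + t ^ 2)) (2 * t / (1 + t ^ 2) ^ 2) s t := by
  have h := ((hasDerivAt_pow 2 t).div ((hasDerivAt_pow 2 t).const_add 1)
    (by positivity)).hasDerivWithinAt (s := s)
  convert! h using 1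
  field_simp
  ring

lemma image_sin_sq : (fun t : ℝ => Real.sin t ^ 2) '' Ioo 0 (π / 2) = Ioo 0 1 := by
  ext x
  constructor
  · rintro ⟨t, ⟨h0, h1⟩, rfl⟩
    have hs := Real.sin_pos_of_pos_of_lt_pi h0 (by linarith)
    have hc := Real.cos_pos_of_mem_Ioo ⟨by linarith, h1⟩
    exact ⟨by positivity, by nlinarith [Real.sin_sq_add_cos_sq t]⟩
  · rintro ⟨h0, h1⟩
    have hs1 : √x < 1 := by rw [Real.sqrt_lt' one_pos]; simpa
    have hs0 := Real.sqrt_pos.2 h0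
    refine ⟨Real.arcsin √x, ⟨Real.arcsin_pos.2 hs0, Real.arcsin_lt_pi_div_two.2 hs1⟩, ?_⟩
    simp only
    rw [Real.sin_arcsin (by linarith) hs1.le, Real.sq_sqrt h0.le]

lemma injOn_sin_sq : InjOn (fun t : ℝ => Real.sin t ^ 2) (Ioo 0 (π / 2)) := by
  intro x hx y hy h
  have hx' := Real.sin_pos_of_pos_of_lt_pi hx.1 (by linarith [hx.2, Real.pi_pos])
  have hy' := Real.sin_pos_of_pos_of_lt_pi hy.1 (by linarith [hy.2, Real.pi_pos])
  exact Real.injOn_sin ⟨by linarith [hx.1, Real.pi_pos], hx.2.le⟩ ⟨by linarith [hy.1, Real.pi_pos], hy.2.le⟩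
    ((pow_left_inj₀ hx'.le hy'.le two_ne_zero).1 h)

lemma hasDerivWithinAt_sin_sq (t : ℝ) (s : Set ℝ) :
    HasDerivWithinAt (fun t : ℝ => Real.sin t ^ 2) (2 * Real.sin t * Real.cos t) s t := by
  convert! ((Real.hasDerivAt_sin t).pow 2).hasDerivWithinAt (s := s) using 1
  simp

lemma Complex.beta_integrand_sq_div_one_add_sq (u v : ℂ) {t : ℝ} (ht : 0 < t) :
    |2 * t / (1 + t ^ 2) ^ 2| • (((t ^ 2 / (1 + t ^ 2) : ℝ) : ℂ) ^ (u - 1)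
        * (1 - ((t ^ 2 / (1 + t ^ 2) : ℝ) : ℂ)) ^ (v - 1))
      = 2 * ((t : ℂ) ^ (2 * u - 1) * ((1 + t ^ 2 : ℝ) : ℂ) ^ (-(u + v))) := by
  have h1 : 0 < 1 + t ^ 2 := by positivity
  have ht' : (t : ℂ) ≠ 0 := by exact_mod_cast ht.ne'
  have h1' : ((1 + t ^ 2 : ℝ) : ℂ) ≠ 0 := by exact_mod_cast h1.ne'
  have e1 : (1 - ((t ^ 2 / (1 + t ^ 2) : ℝ) : ℂ)) = (((1 + t ^ 2)⁻¹ : ℝ) : ℂ) := by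
    rw [← Complex.ofReal_one, ← Complex.ofReal_sub]
    congr 1
    field_simp
    ring
  have e2 : (((1 + t ^ 2)⁻¹ : ℝ) : ℂ) ^ (v - 1) = ((1 + t ^ 2 : ℝ) : ℂ) ^ (-(v - 1)) := by
    rw [Complex.ofReal_inv, Complex.inv_cpow _ _ (by
      rw [Complex.arg_ofReal_of_nonneg h1.le]; exact Real.pi_pos.ne), Complex.cpow_neg]
  have e3 : ((t ^ 2 / (1 + t ^ 2) : ℝ) : ℂ) ^ (u - 1)
      = (t : ℂ) ^ (2 * (u - 1)) * ((1 + t ^ 2 : ℝ) : ℂ) ^ (-(u - 1)) := by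
    rw [div_eq_mul_inv, Complex.ofReal_mul, Complex.mul_cpow_ofReal_nonneg (by positivity)
      (by positivity), Complex.ofReal_inv, Complex.inv_cpow _ _ (by
      rw [Complex.arg_ofReal_of_nonneg h1.le]; exact Real.pi_pos.ne), Complex.cpow_neg,
      sq, Complex.ofReal_mul, Complex.mul_cpow_ofReal_nonneg ht.le ht.le, two_mul,
      Complex.cpow_add _ _ ht']
  have e4 : ((1 + t ^ 2 : ℝ) : ℂ) ^ (-(u + v)) = ((1 + t ^ 2 : ℝ) : ℂ) ^ (-(u - 1))
      * ((1 + t ^ 2 : ℝ) : ℂ) ^ (-(v - 1)) / ((1 + t ^ 2 : ℝ) : ℂ) ^ 2 := by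
    rw [← Complex.cpow_add _ _ h1', ← Complex.cpow_two, ← Complex.cpow_sub _ _ h1']
    congr 1
    ring
  have e5 : (t : ℂ) ^ (2 * u - 1) = (t : ℂ) ^ (2 * (u - 1)) * t := by
    nth_rw 3 [← Complex.cpow_one (t : ℂ)]
    rw [← Complex.cpow_add _ _ ht']
    congr 1
    ring
  rw [e1, e2, e3, e4, e5, abs_of_pos (by positivity), Complex.real_smul]
  push_cast
  ring

lemma Complex.integrableOn_cpow_mul_one_add_sq_cpow {u v : ℂ} (hu : 0 < u.re) (hv : 0 < v.re) :
    IntegrableOn (fun t : ℝ => (t : ℂ) ^ (2 * u - 1) * ((1 + t ^ 2 : ℝ) : ℂ) ^ (-(u + v)))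
      (Ioi 0) := by
  have h := Complex.integrableOn_beta hu hv
  rw [← image_sq_div_one_add_sq, integrableOn_image_iff_integrableOn_abs_deriv_smul
    measurableSet_Ioi (fun t _ => hasDerivWithinAt_sq_div_one_add_sq t _)
    injOn_sq_div_one_add_sq] at h
  refine (Integrable.const_mul h (1 / 2)).congr ?_
  filter_upwards [ae_restrict_mem measurableSet_Ioi] with t ht
  rw [Complex.beta_integrand_sq_div_one_add_sq u v ht]
  ring

lemma Complex.integral_cpow_mul_one_add_sq_cpow {u v : ℂ} (hu : 0 < u.re) (hv : 0 < v.re) :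
    ∫ t in Ioi (0 : ℝ), (t : ℂ) ^ (2 * u - 1) * ((1 + t ^ 2 : ℝ) : ℂ) ^ (-(u + v))
      = Complex.Gamma u * Complex.Gamma v / (2 * Complex.Gamma (u + v)) := by
  have h := Complex.integral_beta hu hv
  rw [← image_sq_div_one_add_sq, integral_image_eq_integral_abs_deriv_smul
    measurableSet_Ioi (fun t _ => hasDerivWithinAt_sq_div_one_add_sq t _)
    injOn_sq_div_one_add_sq, setIntegral_congr_fun measurableSet_Ioi
    (fun t ht => Complex.beta_integrand_sq_div_one_add_sq u v ht), integral_const_mul] at h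
  have := Complex.Gamma_ne_zero_of_re_pos (s := u + v) (by simp; positivity)
  field_simp at h ⊢
  linear_combination h

lemma Real.integral_sin_rpow_mul_cos_pow {b : ℝ} (hb : 0 < b) (k : ℕ) :
    ∫ θ in Ioo 0 (π / 2), Real.sin θ ^ b * Real.cos θ ^ (2 * k)
      = Real.Gamma ((b + 1) / 2) * Real.Gamma (k + 1 / 2) / (2 * Real.Gamma (b / 2 + 1 + k)) := by
  have h := Real.integral_beta (u := (b + 1) / 2) (v := k + 1 / 2) (by positivity) (by positivity)
  have hcongr (θ : ℝ) (hθ : θ ∈ Ioo 0 (π / 2)) :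
      |2 * Real.sin θ * Real.cos θ| • ((Real.sin θ ^ 2) ^ ((b + 1) / 2 - 1)
        * (1 - Real.sin θ ^ 2) ^ ((k : ℝ) + 1 / 2 - 1))
      = 2 * (Real.sin θ ^ b * Real.cos θ ^ (2 * k)) := by
    have hs := Real.sin_pos_of_pos_of_lt_pi hθ.1 (by linarith [hθ.2, Real.pi_pos])
    have hc := Real.cos_pos_of_mem_Ioo ⟨by linarith [hθ.1, Real.pi_pos], hθ.2⟩
    rw [← Real.cos_sq', ← Real.rpow_natCast_mul hs.le, ← Real.rpow_natCast_mul hc.le,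
      abs_of_pos (by positivity), smul_eq_mul,
      show ((2 : ℕ) : ℝ) * ((b + 1) / 2 - 1) = b - 1 by push_cast; ring,
      show ((2 : ℕ) : ℝ) * ((k : ℝ) + 1 / 2 - 1) = ((2 * k : ℕ) : ℝ) - 1 by push_cast; ring,
      Real.rpow_sub_one hs.ne', Real.rpow_sub_one hc.ne', Real.rpow_natCast]
    field_simp
  rw [← image_sin_sq, integral_image_eq_integral_abs_deriv_smul
    measurableSet_Ioo (fun t _ => hasDerivWithinAt_sin_sq t _)
    injOn_sin_sq, setIntegral_congr_fun measurableSet_Ioo hcongr, integral_const_mul,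
    show (b + 1) / 2 + (k + 1 / 2) = b / 2 + 1 + k by ring] at h
  have := (Real.Gamma_pos_of_pos (s := b / 2 + 1 + k) (by positivity)).ne'
  field_simp at h ⊢
  linear_combination h

lemma Real.integral_sin_rpow_mul_cos_pow_zero_pi {b : ℝ} (hb : 0 < b) (n : ℕ) :
    ∫ θ in 0..π, Real.sin θ ^ b * Real.cos θ ^ n
      = (1 + (-1) ^ n) * ∫ θ in Ioo 0 (π / 2), Real.sin θ ^ b * Real.cos θ ^ n := by
  have hcont : Continuous fun θ => Real.sin θ ^ b * Real.cos θ ^ n :=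
    (Real.continuous_sin.rpow_const fun _ => Or.inr hb.le).mul (Real.continuous_cos.pow n)
  have h2 : ∫ θ in (π / 2)..π, Real.sin θ ^ b * Real.cos θ ^ n
      = (-1) ^ n * ∫ θ in 0..(π / 2), Real.sin θ ^ b * Real.cos θ ^ n := by
    have := intervalIntegral.integral_comp_sub_left (a := 0) (b := π / 2)
      (fun θ => Real.sin θ ^ b * Real.cos θ ^ n) π
    rw [sub_zero, sub_half] at this
    rw [← this, ← intervalIntegral.integral_const_mul]
    congr 1
    ext θ
    rw [Real.sin_pi_sub, Real.cos_pi_sub, neg_pow]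
    ring
  rw [← intervalIntegral.integral_add_adjacent_intervals (hcont.intervalIntegrable 0 (π / 2))
    (hcont.intervalIntegrable _ _), h2, intervalIntegral.integral_of_le (by positivity),
    integral_Ioc_eq_integral_Ioo]
  ring

lemma Real.Gamma_nat_add_half_mul_four_pow (k : ℕ) :
    Real.Gamma (k + 1 / 2) * 4 ^ k * k ! = (2 * k)! * √π := by
  have h := Real.Gamma_mul_Gamma_add_half (k + 1 / 2)
  rw [show (k : ℝ) + 1 / 2 + 1 / 2 = k + 1 by ring, Real.Gamma_nat_eq_factorial,
    show 2 * ((k : ℝ) + 1 / 2) = ((2 * k : ℕ) : ℝ) + 1 by push_cast; ring,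
    Real.Gamma_nat_eq_factorial, show 1 - (((2 * k : ℕ) : ℝ) + 1) = -((2 * k : ℕ) : ℝ) by ring,
    Real.rpow_neg zero_le_two, Real.rpow_natCast, pow_mul] at h
  rw [show (2 : ℝ) ^ 2 = 4 by norm_num] at h
  rw [mul_right_comm, h]
  field_simp

/-- Expansion of the angular integral in powers of `2t / (1 + t²)`, reorganised termwise. -/
lemma hasSum_integral_sin_rpow_mul_rpow {b s t : ℝ} (hb : 0 < b) (hs : 0 < s) (ht : 0 < t)
    (ht1 : t ≠ 1) :
    HasSum (fun k : ℕ => √π * Real.Gamma ((b + 1) / 2) / Real.Gamma s *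
        (Real.Gamma (s + 2 * k) / (k ! * Real.Gamma (b / 2 + 1 + k)) *
          (t ^ (2 * k) * (1 + t ^ 2) ^ (-(s + 2 * k)))))
      (∫ θ in (0 : ℝ)..π, Real.sin θ ^ b * (1 - 2 * t * Real.cos θ + t ^ 2) ^ (-s)) := by
  have hq : 0 < 1 + t ^ 2 := by positivity
  set u := 2 * t / (1 + t ^ 2) with hu
  have hu0 : 0 < u := by positivity
  have hu1 : u < 1 := by
    rw [hu, div_lt_one hq]
    have := sub_ne_zero.2 ht1
    nlinarith [sq_pos_of_ne_zero this]
  have hΓs := Real.Gamma_pos_of_pos hs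
  have hΓ (n : ℕ) : 0 < Real.Gamma (s + n) := Real.Gamma_pos_of_pos (by positivity)
  have hsin {θ : ℝ} (hθ : θ ∈ uIoc 0 π) : 0 ≤ Real.sin θ := by
    rw [uIoc_of_le Real.pi_pos.le] at hθ
    exact Real.sin_nonneg_of_nonneg_of_le_pi hθ.1.le hθ.2
  have hall : HasSum (fun n : ℕ => ∫ θ in (0 : ℝ)..π,
        (1 + t ^ 2) ^ (-s) / Real.Gamma s * (Real.Gamma (s + n) / n ! * u ^ n) *
          (Real.sin θ ^ b * Real.cos θ ^ n))
      (∫ θ in (0 : ℝ)..π, Real.sin θ ^ b * (1 - 2 * t * Real.cos θ + t ^ 2) ^ (-s)) := by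
    have hsum := (Real.hasSum_Gamma_add_nat_mul_pow hs
      (by rwa [abs_of_pos hu0])).summable.mul_left ((1 + t ^ 2) ^ (-s) / Real.Gamma s)
    refine intervalIntegral.hasSum_integral_of_dominated_convergence
      (fun n _ => (1 + t ^ 2) ^ (-s) / Real.Gamma s * (Real.Gamma (s + n) / n ! * u ^ n))
      (fun n => ?_) (fun n => ?_) ?_ ?_ ?_
    · exact (((Real.continuous_sin.rpow_const fun _ => Or.inr hb.le).mul
        (Real.continuous_cos.pow n)).const_mul _).aestronglyMeasurable
    · refine Eventually.of_forall fun θ hθ => ?_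
      have hc : 0 ≤ (1 + t ^ 2) ^ (-s) / Real.Gamma s * (Real.Gamma (s + n) / n ! * u ^ n) := by
        have := hΓ n
        positivity
      rw [norm_mul, Real.norm_of_nonneg hc]
      refine mul_le_of_le_one_right hc ?_
      rw [norm_mul, norm_pow, Real.norm_of_nonneg (Real.rpow_nonneg (hsin hθ) _)]
      exact mul_le_one₀ (Real.rpow_le_one (hsin hθ) (Real.sin_le_one θ) hb.le) (by positivity)
        (pow_le_one₀ (norm_nonneg _) (Real.abs_cos_le_one θ))
    · exact Eventually.of_forall fun θ _ => hsum
    · exact intervalIntegrable_const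
    · refine Eventually.of_forall fun θ _ => ?_
      have hlt : |u * Real.cos θ| < 1 := by
        rw [abs_mul, abs_of_pos hu0]
        exact (mul_le_of_le_one_right hu0.le (Real.abs_cos_le_one θ)).trans_lt hu1
      have h := (Real.hasSum_Gamma_add_nat_mul_pow hs hlt).mul_left
        ((1 + t ^ 2) ^ (-s) / Real.Gamma s * Real.sin θ ^ b)
      convert! h using 1
      · ext n
        rw [mul_pow]
        ring
      · rw [show 1 - 2 * t * Real.cos θ + t ^ 2 = (1 + t ^ 2) * (1 - u * Real.cos θ) by
            rw [hu]; field_simp; ring,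
          Real.mul_rpow hq.le (by linarith [le_abs_self (u * Real.cos θ)])]
        field_simp
  have hinj : Function.Injective fun k : ℕ => 2 * k := mul_right_injective₀ two_ne_zero
  rw [← hinj.hasSum_iff] at hall
  · convert! hall using 1
    ext k
    have hpow : (1 + t ^ 2) ^ (-(s + 2 * k)) = (1 + t ^ 2) ^ (-s) / (1 + t ^ 2) ^ (2 * k) := by
      rw [neg_add, Real.rpow_add hq, Real.rpow_neg hq.le (2 * (k : ℝ)), div_eq_mul_inv]
      norm_cast
    have hk := Real.Gamma_nat_add_half_mul_four_pow k
    have := (Real.Gamma_pos_of_pos (s := b / 2 + 1 + k) (by positivity)).ne'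
    have h4 : (2 * t) ^ (2 * k) = 4 ^ k * t ^ (2 * k) := by
      rw [mul_pow, pow_mul 2]
      norm_num
    simp only [Function.comp_apply]
    rw [intervalIntegral.integral_const_mul, Real.integral_sin_rpow_mul_cos_pow_zero_pi hb,
      Real.integral_sin_rpow_mul_cos_pow hb, hpow, hu, div_pow, h4, pow_mul (-1 : ℝ)]
    generalize Real.Gamma (k + 1 / 2) = G at hk ⊢
    push_cast
    norm_num
    field_simp
    linear_combination -hk
  · intro n hn
    have hodd : Odd n := by
      rw [← Nat.not_even_iff_odd]
      rintro ⟨k, rfl⟩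
      exact hn ⟨k, by ring⟩
    rw [intervalIntegral.integral_const_mul, Real.integral_sin_rpow_mul_cos_pow_zero_pi hb,
      hodd.neg_one_pow]
    ring

lemma integrable_of_hasSum_of_summable_integral_norm {α E : Type*} [MeasurableSpace α]
    {μ : Measure α} [NormedAddCommGroup E] {F : ℕ → α → E} {f : α → E}
    (hF : ∀ i, Integrable (F i) μ) (hsum : Summable fun i => ∫ a, ‖F i a‖ ∂μ)
    (hf : ∀ᵐ a ∂μ, HasSum (fun i => F i a) (f a)) : Integrable f μ := by
  refine ⟨aestronglyMeasurable_of_tendsto_ae atTop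
    (fun n => Finset.aestronglyMeasurable_fun_sum (Finset.range n) fun i _ =>
      (hF i).aestronglyMeasurable) (hf.mono fun a h => h.tendsto_sum_nat), ?_⟩
  calc ∫⁻ a, ‖f a‖ₑ ∂μ ≤ ∫⁻ a, ∑' i, ‖F i a‖ₑ ∂μ := by
        refine lintegral_mono_ae (hf.mono fun a h => ?_)
        rw [← h.tsum_eq]
        exact enorm_tsum_le_tsum_enorm
    _ = ∑' i, ∫⁻ a, ‖F i a‖ₑ ∂μ := lintegral_tsum fun i => (hF i).aestronglyMeasurable.enorm
    _ = ∑' i, ENNReal.ofReal (∫ a, ‖F i a‖ ∂μ) := by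
        congr 1
        ext i
        rw [ofReal_integral_norm_eq_lintegral_enorm (hF i)]
    _ < ⊤ := hsum.tsum_ofReal_lt_top

/-- For `a ∈ ℝ`, `b > 0`, `s > 0` with `b + 2 − 2s > 0` and `z ∈ ℂ` with
`−a < Re z < 2s − a`, the Mellin transform `∫₀^∞ t^{z−1} f_{a,b,s}(t) dt` converges absolutely
and equals
`(√π Γ((b−2s+2)/2) Γ((b+1)/2) / (2Γ(s))) · Γ((2s−z−a)/2) Γ((z+a)/2)
  / (Γ((b−a−z+2)/2) Γ((b+a−2s+2+z)/2))`. -/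
theorem stmt4 (a b s : ℝ) (hb : 0 < b) (hs : 0 < s) (hbs : 0 < b + 2 - 2*s)
    (z : ℂ) (h1 : -a < z.re) (h2 : z.re < 2*s - a) :
    IntegrableOn (fun t : ℝ => (t : ℂ) ^ (z - 1) * ((fabs a b s t : ℝ) : ℂ)) (Set.Ioi 0) ∧
    (∫ t in Set.Ioi (0:ℝ), (t : ℂ) ^ (z - 1) * ((fabs a b s t : ℝ) : ℂ))
      = ((Real.sqrt π * Real.Gamma ((b - 2*s + 2)/2) * Real.Gamma ((b + 1)/2)
            / (2 * Real.Gamma s) : ℝ) : ℂ)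
        * (Complex.Gamma ((2*(s:ℂ) - z - (a:ℂ))/2) * Complex.Gamma ((z + (a:ℂ))/2)
          / (Complex.Gamma (((b:ℂ) - (a:ℂ) - z + 2)/2)
              * Complex.Gamma (((b:ℂ) + (a:ℂ) - 2*(s:ℂ) + 2 + z)/2))) := by
  set u : ℂ := (z + a) / 2 with hu
  set v : ℂ := (2 * s - z - a) / 2 with hv
  have hre : 0 < u.re := by simp [hu]; linarith
  have hve : 0 < v.re := by simp [hv]; linarith
  have huv : u + v = s := by rw [hu, hv]; ring
  set C : ℝ := √π * Real.Gamma ((b + 1) / 2) / Real.Gamma s with hC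
  set d : ℕ → ℝ := fun k => Real.Gamma (s + 2 * k) / (k ! * Real.Gamma (b / 2 + 1 + k)) with hd
  have hre (k : ℕ) : 0 < (u + k).re := by simp; positivity
  have hve (k : ℕ) : 0 < (v + k).re := by simp; positivity
  have hΓs := Real.Gamma_pos_of_pos hs
  have hd0 (k : ℕ) : 0 < d k := div_pos (Real.Gamma_pos_of_pos (by positivity))
    (mul_pos (by positivity) (Real.Gamma_pos_of_pos (by positivity)))
  have hC0 : 0 < C := by
    have := Real.Gamma_pos_of_pos (s := (b + 1) / 2) (by positivity)
    positivity
  let F (k : ℕ) (t : ℝ) : ℂ := (C * d k : ℝ) *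
    ((t : ℂ) ^ (2 * (u + k) - 1) * ((1 + t ^ 2 : ℝ) : ℂ) ^ (-(u + k + (v + k))))
  have hF (k : ℕ) : IntegrableOn (F k) (Ioi 0) :=
    (Complex.integrableOn_cpow_mul_one_add_sq_cpow (hre k) (hve k)).const_mul _
  -- the beta integrals turn the series into a Gauss series
  have hcoef (k : ℕ) (x y : ℂ) (hxy : x + y = s) :
      ((C * d k : ℝ) : ℂ) * (Complex.Gamma (x + k) * Complex.Gamma (y + k)
        / (2 * Complex.Gamma (x + k + (y + k)))) = C / 2 * (Complex.Gamma (x + k) *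
          Complex.Gamma (y + k) / (k ! * Complex.Gamma ((b / 2 + 1 : ℝ) + k))) := by
    have hG : Complex.Gamma (x + k + (y + k)) = Real.Gamma (s + 2 * k) := by
      rw [← Complex.Gamma_ofReal]
      congr 1
      push_cast
      linear_combination hxy
    have hG' : Complex.Gamma ((b / 2 + 1 : ℝ) + k) = Real.Gamma (b / 2 + 1 + k) := by
      rw [← Complex.Gamma_ofReal]
      push_cast
      rfl
    have h0 : (Real.Gamma (s + 2 * k) : ℂ) ≠ 0 := by
      exact_mod_cast (Real.Gamma_pos_of_pos (by positivity)).ne'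
    rw [hG, hG', hd]
    push_cast
    field_simp
  have hgauss (x y : ℂ) (hx : 0 < x.re) (hy : 0 < y.re) (hxy : x + y = s) :=
    Complex.hasSum_Gamma_gauss (c := (b / 2 + 1 : ℝ)) hx hy (by
      rw [sub_sub, hxy, ← Complex.ofReal_sub, Complex.ofReal_re]; linarith)
  have hFint (k : ℕ) : ∫ t in Ioi 0, F k t = C / 2 * (Complex.Gamma (u + k) *
      Complex.Gamma (v + k) / (k ! * Complex.Gamma ((b / 2 + 1 : ℝ) + k))) := by
    simp only [F]
    rw [integral_const_mul, Complex.integral_cpow_mul_one_add_sq_cpow (hre k) (hve k),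
      hcoef k u v huv]
  have hnorm (k : ℕ) : ((∫ t in Ioi 0, ‖F k t‖ : ℝ) : ℂ) = C / 2 *
      (Complex.Gamma ((u.re : ℂ) + k) * Complex.Gamma ((v.re : ℂ) + k)
        / (k ! * Complex.Gamma ((b / 2 + 1 : ℝ) + k))) := by
    have huvre : (u.re : ℂ) + v.re = s := by
      rw [← Complex.ofReal_add, ← Complex.add_re, huv, Complex.ofReal_re]
    rw [← hcoef k _ _ huvre, ← Complex.integral_cpow_mul_one_add_sq_cpow
      (by simpa using hre k) (by simpa using hve k), ← integral_const_mul,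
      ← integral_complex_ofReal]
    refine setIntegral_congr_fun measurableSet_Ioi fun t (ht : 0 < t) => ?_
    have hq : 0 < 1 + t ^ 2 := by positivity
    simp only [F]
    rw [norm_mul, norm_mul, Complex.norm_cpow_eq_rpow_re_of_pos ht,
      Complex.norm_cpow_eq_rpow_re_of_pos hq, Complex.norm_real,
      Real.norm_of_nonneg (mul_pos hC0 (hd0 k)).le]
    push_cast [Complex.ofReal_cpow ht.le, Complex.ofReal_cpow hq.le]
    simp
  have hsum : Summable fun k => ∫ t in Ioi 0, ‖F k t‖ := by
    rw [← Complex.summable_ofReal]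
    simp only [hnorm]
    refine ((hgauss u.re v.re ?_ ?_ ?_).summable).mul_left _
    · simpa using hre 0
    · simpa using hve 0
    · rw [← Complex.ofReal_add, ← Complex.add_re, huv, Complex.ofReal_re]
  have hlim : ∀ᵐ t ∂(volume.restrict (Ioi (0 : ℝ))),
      HasSum (fun k => F k t) ((t : ℂ) ^ (z - 1) * ((fabs a b s t : ℝ) : ℂ)) := by
    filter_upwards [ae_restrict_mem measurableSet_Ioi,
      ae_restrict_of_ae (Measure.ae_ne volume (1 : ℝ))] with t (ht : 0 < t) ht1
    have ht' : (t : ℂ) ≠ 0 := by exact_mod_cast ht.ne'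
    have hq : 0 < 1 + t ^ 2 := by positivity
    have h := (Complex.hasSum_ofReal.2 (hasSum_integral_sin_rpow_mul_rpow hb hs ht ht1)).mul_left
      ((t : ℂ) ^ (z + a - 1))
    convert! h using 1
    · ext k
      have e1 : (t : ℂ) ^ (2 * (u + k) - 1) = (t : ℂ) ^ (z + a - 1) * (t : ℂ) ^ (2 * k) := by
        rw [← Complex.cpow_natCast, ← Complex.cpow_add _ _ ht']
        congr 1
        rw [hu]
        push_cast
        ring
      have e2 : ((1 + t ^ 2 : ℝ) : ℂ) ^ (-(u + k + (v + k)))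
          = (((1 + t ^ 2) ^ (-(s + 2 * k)) : ℝ) : ℂ) := by
        rw [Complex.ofReal_cpow hq.le]
        congr 1
        push_cast
        linear_combination -huv
      simp only [F]
      rw [e1, e2, hd, hC]
      push_cast
      ring
    · rw [fabs, Complex.ofReal_mul, Complex.ofReal_cpow ht.le, ← mul_assoc,
        ← Complex.cpow_add _ _ ht']
      congr 2
      ring
  refine ⟨integrable_of_hasSum_of_summable_integral_norm hF hsum hlim, ?_⟩
  have hI := hasSum_integral_of_summable_integral_norm hF hsum
  rw [integral_congr_ae (hlim.mono fun t ht => ht.tsum_eq)] at hI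
  simp only [hFint] at hI
  rw [hI.unique ((hgauss u v (by simpa using hre 0) (by simpa using hve 0) huv).mul_left _),
    show ((b / 2 + 1 : ℝ) : ℂ) - u - v = ((b - 2 * s + 2) / 2 : ℝ) by
      push_cast
      linear_combination -huv,
    Complex.Gamma_ofReal,
    show ((b / 2 + 1 : ℝ) : ℂ) - u = (b - a - z + 2) / 2 by rw [hu]; push_cast; ring,
    show ((b / 2 + 1 : ℝ) : ℂ) - v = (b + a - 2 * s + 2 + z) / 2 by rw [hv]; push_cast; ring, hC]
  push_cast
  ring
end
end
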